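/- For a bounded domain Ω ⊆ ℂ the following are equivalent: (1) ∂Ω is a Peano compactum; (2) Ω has property S; (3) every point of ∂Ω is locally accessible from Ω; (4) every point of ∂Ω is locally sequentially accessible; (5) Ω is finitely connected at the boundary; (6) the completion of the metric space (Ω, d), where d is the diameter (Mazurkiewicz) distance, is compact. -/

import Mathlib

open Set Metric Filter MeasureTheory Topology

noncomputable section

/-- A planar domain: a nonempty open connected subset of ℂ. -/
def IsPlanarDomain (D : Set ℂ) : Prop := D.Nonempty ∧ IsOpen D ∧ IsConnected D

/-- A Peano compactum: a compact subset of ℂ all of whose connected components are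
locally connected (as subspaces of ℂ) and such that for every `C > 0` only finitely
many components have diameter greater than `C`. -/
def IsPeanoCompactum (K : Set ℂ) : Prop :=
  IsCompact K ∧
  (∀ x ∈ K, LocallyConnectedSpace ↥(connectedComponentIn K x)) ∧
  ∀ C : ℝ, 0 < C →
    {Q : Set ℂ | (∃ x ∈ K, Q = connectedComponentIn K x) ∧ C < Metric.diam Q}.Finite

/-- A Jordan curve: a subset of ℂ homeomorphic to the unit circle. -/
def IsJordanCurve (J : Set ℂ) : Prop :=
  Nonempty (↥J ≃ₜ ↥(Metric.sphere (0:ℂ) 1))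

/-- A generalized Jordan domain: a bounded domain whose boundary is a Peano compactum,
each of whose boundary components is a single point or a Jordan curve. -/
def IsGeneralizedJordanDomain (D : Set ℂ) : Prop :=
  IsPlanarDomain D ∧ Bornology.IsBounded D ∧
  IsPeanoCompactum (frontier D) ∧
  ∀ x ∈ frontier D,
    connectedComponentIn (frontier D) x = {x} ∨
    IsJordanCurve (connectedComponentIn (frontier D) x)

/-- `φ` restricts to a homeomorphism of `D` onto `Ω`. -/
def IsHomeoOnto (φ : ℂ → ℂ) (D Ω : Set ℂ) : Prop :=
  ContinuousOn φ D ∧ Set.BijOn φ D Ω ∧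
  ∃ ψ : ℂ → ℂ, ContinuousOn ψ Ω ∧ Set.InvOn ψ φ D Ω

/-- `φ` is a conformal homeomorphism (holomorphic bijection) of `D` onto `Ω`. -/
def IsConformalHomeoOnto (φ : ℂ → ℂ) (D Ω : Set ℂ) : Prop :=
  DifferentiableOn ℂ φ D ∧ Set.BijOn φ D Ω

/-- `φb` is a continuous extension of `φ : D → Ω` to `closure D`, with values in `closure Ω`. -/
def ExtendsContinuously (φ φb : ℂ → ℂ) (D Ω : Set ℂ) : Prop :=
  ContinuousOn φb (closure D) ∧ Set.EqOn φb φ D ∧ Set.MapsTo φb (closure D) (closure Ω)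

/-- The oscDiam `σ_r(z₀) = diam φ(D ∩ C_r(z₀))`. -/
def oscDiam (φ : ℂ → ℂ) (D : Set ℂ) (z₀ : ℂ) (r : ℝ) : ℝ :=
  Metric.diam (φ '' (D ∩ Metric.sphere z₀ r))

/-- `liminf_{r→0⁺} σ_r(z₀) = 0`. -/
def OscLiminfZero (φ : ℂ → ℂ) (D : Set ℂ) (z₀ : ℂ) : Prop :=
  Filter.liminf (oscDiam φ D z₀) (nhdsWithin (0:ℝ) (Set.Ioi 0)) = 0

/-- A circle domain (normalized so that ∞ lies in a complementary disk): every bounded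
complementary component is a point or a closed round disk, and the unbounded
complementary component is the complement of an open round disk. -/
def IsCircleDomain (D : Set ℂ) : Prop :=
  IsPlanarDomain D ∧ Bornology.IsBounded D ∧
  ∀ x ∈ Dᶜ,
    (Bornology.IsBounded (connectedComponentIn Dᶜ x) →
      connectedComponentIn Dᶜ x = {x} ∨
      ∃ c : ℂ, ∃ rad : ℝ, 0 < rad ∧ connectedComponentIn Dᶜ x = Metric.closedBall c rad) ∧
    (¬ Bornology.IsBounded (connectedComponentIn Dᶜ x) →
      ∃ c : ℂ, ∃ rad : ℝ, 0 < rad ∧ connectedComponentIn Dᶜ x = (Metric.ball c rad)ᶜ)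

/-- A set has σ-finite linear (1-dimensional Hausdorff) measure. -/
def SigmaFiniteH1 (E : Set ℂ) : Prop :=
  ∃ f : ℕ → Set ℂ, (⋃ n, f n) = E ∧ ∀ n, μH[1] (f n) < ⊤

/-- The set of connected components of `K` containing more than one point. -/
def NondegComponents (K : Set ℂ) : Set (Set ℂ) :=
  {Q | (∃ x ∈ K, Q = connectedComponentIn K x) ∧ ∃ a ∈ Q, ∃ b ∈ Q, a ≠ b}

/-- The union of the singleton connected components of `K`. -/
def SingletonPart (K : Set ℂ) : Set ℂ :=
  {x | x ∈ K ∧ connectedComponentIn K x = {x}}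

/-- The cluster set `C(h, z₀) = ⋂_{r>0} closure h({z ∈ U : |z − z₀| < r})`. -/
def clusterSet (h : ℂ → ℂ) (U : Set ℂ) (z₀ : ℂ) : Set ℂ :=
  ⋂ r ∈ Set.Ioi (0:ℝ), closure (h '' (U ∩ Metric.ball z₀ r))

/-- The boundary component of `Ω` corresponding (under `φ : D → Ω`) to a boundary
component `Q` of `D`: `φ^B(Q) = ⋃_{z ∈ Q} C(φ, z)`. -/
def boundaryComp (φ : ℂ → ℂ) (D : Set ℂ) (Q : Set ℂ) : Set ℂ :=
  ⋃ z ∈ Q, clusterSet φ D z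

/-- An arc: the image of a continuous injective map from `[0,1]`. -/
def IsArc (A : Set ℂ) : Prop :=
  ∃ f : ℝ → ℂ, ContinuousOn f (Set.Icc 0 1) ∧ Set.InjOn f (Set.Icc 0 1) ∧
    f '' Set.Icc 0 1 = A

/-- An arc from `a` to `b`. -/
def IsArcFromTo (A : Set ℂ) (a b : ℂ) : Prop :=
  ∃ f : ℝ → ℂ, ContinuousOn f (Set.Icc 0 1) ∧ Set.InjOn f (Set.Icc 0 1) ∧
    f '' Set.Icc 0 1 = A ∧ f 0 = a ∧ f 1 = b

/-- Property S: for every `ε > 0`, `Ω` is a finite union of connected sets of diameter `< ε`. -/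
def PropertyS (Ω : Set ℂ) : Prop :=
  ∀ ε > (0:ℝ), ∃ (k : ℕ) (N : Fin k → Set ℂ),
    (∀ i, IsConnected (N i) ∧ Metric.diam (N i) < ε) ∧ (⋃ i, N i) = Ω

/-- `x ∈ ∂Ω` is locally accessible from `Ω`. -/
def LocallyAccessible (Ω : Set ℂ) (x : ℂ) : Prop :=
  ∀ ε > (0:ℝ), ∃ δ > (0:ℝ), ∀ z ∈ Ω, dist z x < δ →
    ∃ A : Set ℂ, IsArcFromTo A z x ∧ A ⊆ Ω ∪ {x} ∧ Metric.diam A < ε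

/-- `ξ ∈ ∂Ω` is locally sequentially accessible. -/
def LocallySeqAccessible (Ω : Set ℂ) (ξ : ℂ) : Prop :=
  ∀ r > (0:ℝ), ∀ ξn : ℕ → ℂ, (∀ n, ξn n ∈ Ω) → Filter.Tendsto ξn Filter.atTop (nhds ξ) →
    ∃ x ∈ Ω ∩ Metric.ball ξ r,
      {n : ℕ | ξn n ∈ connectedComponentIn (Ω ∩ Metric.ball ξ r) x}.Infinite

/-- `Ω` is finitely connected at the boundary point `x`. -/
def FinitelyConnectedAt (Ω : Set ℂ) (x : ℂ) : Prop :=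
  ∀ r > (0:ℝ), ∃ U : Set ℂ, IsOpen U ∧ x ∈ U ∧ U ⊆ Metric.ball x r ∧
    {Q : Set ℂ | ∃ y ∈ U ∩ Ω, Q = connectedComponentIn (U ∩ Ω) y}.Finite

/-- The diameter (Mazurkiewicz) distance on `Ω`. -/
def mazDist (Ω : Set ℂ) (x y : ℂ) : ℝ :=
  sInf (Metric.diam '' {E : Set ℂ | E ⊆ Ω ∧ IsConnected E ∧ x ∈ E ∧ y ∈ E})

/-- `Ω` is totally bounded for the Mazurkiewicz distance; for a metric space this is
equivalent to compactness of the metric completion of `(Ω, mazDist)`. -/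
def MazCompletionCompact (Ω : Set ℂ) : Prop :=
  ∀ ε > (0:ℝ), ∃ F : Finset ℂ, ↑F ⊆ Ω ∧ ∀ x ∈ Ω, ∃ y ∈ F, mazDist Ω x y < ε

/-- `f : A → B` is non-alternating: there are no `x, y ∈ B` and no separation of
`A \ f⁻¹({x})` into two disjoint nonempty relatively open sets `A₁, A₂` with
`y ∈ f(A₁) ∩ f(A₂)`. -/
def NonAlternatingOn (f : ℂ → ℂ) (A B : Set ℂ) : Prop :=
  ¬ ∃ x ∈ B, ∃ y ∈ B, ∃ A₁ A₂ : Set ℂ,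
      A₁.Nonempty ∧ A₂.Nonempty ∧ Disjoint A₁ A₂ ∧
      A₁ ∪ A₂ = {z | z ∈ A ∧ f z ≠ x} ∧
      (∃ U₁ : Set ℂ, IsOpen U₁ ∧ A₁ = U₁ ∩ {z | z ∈ A ∧ f z ≠ x}) ∧
      (∃ U₂ : Set ℂ, IsOpen U₂ ∧ A₂ = U₂ ∩ {z | z ∈ A ∧ f z ≠ x}) ∧
      y ∈ f '' A₁ ∧ y ∈ f '' A₂

/-- Two continuous logarithms of the same function on a preconnected set differ by a constant. -/
lemma IsPreconnected.sub_eq_sub_of_exp_eq {X : Type*} [TopologicalSpace X] {T : Set X}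
    (hT : IsPreconnected T) {g h : X → ℂ} (hg : ContinuousOn g T) (hh : ContinuousOn h T)
    (he : ∀ x ∈ T, Complex.exp (g x) = Complex.exp (h x)) {x y : X} (hx : x ∈ T) (hy : y ∈ T) :
    g x - h x = g y - h y := by
  have hk : ∀ z ∈ T, ∃ n : ℤ, g z - h z = n * (2 * Real.pi * Complex.I) := fun z hz => by
    rw [← Complex.exp_eq_one_iff, Complex.exp_sub, he z hz, div_self (Complex.exp_ne_zero _)]
  have key : ∀ x ∈ T, ∀ y ∈ T, ∀ n m : ℤ, g x - h x = n * (2 * Real.pi * Complex.I) →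
      g y - h y = m * (2 * Real.pi * Complex.I) → ¬ n < m := by
    intro x hx y hy n m hn hm hlt
    have hc : ContinuousOn (fun z => (g z - h z).im) T :=
      Complex.continuous_im.comp_continuousOn (hg.sub hh)
    have hmem : 2 * Real.pi * n + Real.pi ∈ Icc (g x - h x).im (g y - h y).im := by
      have hnm : (n : ℝ) + 1 ≤ m := by exact_mod_cast hlt
      have := Real.pi_pos
      rw [hn, hm]
      constructor <;> simp <;> nlinarith
    obtain ⟨z, hz, hzv⟩ := hT.intermediate_value hx hy hc hmem
    obtain ⟨l, hl⟩ := hk z hz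
    simp only [hl] at hzv
    have h2 : (l : ℝ) * (2 * Real.pi) = 2 * Real.pi * n + Real.pi := by
      simpa using hzv
    have h3 : (2 * l : ℝ) = 2 * n + 1 := by
      have := Real.pi_pos
      apply mul_left_cancel₀ this.ne'
      linarith
    have h4 : 2 * l = 2 * n + 1 := by exact_mod_cast h3
    omega
  obtain ⟨n, hn⟩ := hk x hx
  obtain ⟨m, hm⟩ := hk y hy
  have : n = m := le_antisymm (not_lt.1 (key y hy x hx m n hm hn))
    (not_lt.1 (key x hx y hy n m hn hm))
  rw [hn, hm, this]

/-- A nowhere vanishing continuous function on the plane has a continuous logarithm. -/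
lemma exists_continuous_log {f : ℂ → ℂ} (hf : Continuous f) (h0 : ∀ z, f z ≠ 0) :
    ∃ g : ℂ → ℂ, Continuous g ∧ ∀ z, Complex.exp (g z) = f z := by
  obtain ⟨g, ⟨-, hg⟩, -⟩ := Complex.isCoveringMapOn_exp.existsUnique_continuousMap_lifts
    (⟨f, hf⟩ : C(ℂ, ℂ)) (a₀ := 0) (Complex.exp_log (h0 0)) (fun x => h0 x)
  exact ⟨g, g.continuous, fun z => congrFun hg z⟩

/-- The plane is unicoherent. -/
lemma isPreconnected_inter_of_union_eq_univ {A B : Set ℂ} (hA : IsClosed A) (hB : IsClosed B)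
    (hAc : IsPreconnected A) (hBc : IsPreconnected B) (hAB : A ∪ B = univ) :
    IsPreconnected (A ∩ B) := by
  classical
  rw [isPreconnected_iff_subset_of_fully_disjoint_closed (hA.inter hB)]
  intro u v hu hv huv hd
  by_contra! hcon
  obtain ⟨⟨q, hq, hqu⟩, ⟨p, hp, hpv⟩⟩ : (∃ q ∈ A ∩ B, q ∉ u) ∧ ∃ p ∈ A ∩ B, p ∉ v :=
    ⟨not_subset.1 hcon.1, not_subset.1 hcon.2⟩
  have hqv : q ∈ v := (huv hq).resolve_left hqu
  have hpu : p ∈ u := (huv hp).resolve_right hpv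
  obtain ⟨f, hf0, hf1, -⟩ := exists_continuous_zero_one_of_isClosed hu hv hd
  have hf : Continuous fun z => (f z : ℂ) := Complex.continuous_ofReal.comp f.continuous
  set F : ℂ → ℂ := fun z => if z ∈ A then Complex.exp (f z * (Real.pi * Complex.I))
    else Complex.exp (-(f z * (Real.pi * Complex.I))) with hF
  have hFA : EqOn F (fun z => Complex.exp (f z * (Real.pi * Complex.I))) A :=
    fun z hz => if_pos hz
  have hFB : EqOn F (fun z => Complex.exp (-(f z * (Real.pi * Complex.I)))) B := by
    intro z hz
    by_cases hzA : z ∈ A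
    · rw [hFA hzA]
      rcases huv ⟨hzA, hz⟩ with h | h
      · simp [hf0 h]
      · simp [hf1 h, Complex.exp_neg]
    · exact if_neg hzA
  have hFc : Continuous F := by
    rw [← continuousOn_univ, ← hAB]
    refine ContinuousOn.union_of_isClosed (ContinuousOn.congr ?_ hFA)
      (ContinuousOn.congr ?_ hFB) hA hB
    · exact (Complex.continuous_exp.comp (hf.mul continuous_const)).continuousOn
    · exact (Complex.continuous_exp.comp (hf.mul continuous_const).neg).continuousOn
  obtain ⟨g, hg, hge⟩ := exists_continuous_log hFc (fun z => by
    simp only [hF]; split_ifs <;> exact Complex.exp_ne_zero _)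
  have h1 := hAc.sub_eq_sub_of_exp_eq (h := fun z => f z * (Real.pi * Complex.I)) hg.continuousOn
    (hf.mul continuous_const).continuousOn (fun z hz => (hge z).trans (hFA hz)) hp.1 hq.1
  have h2 := hBc.sub_eq_sub_of_exp_eq (h := fun z => -(f z * (Real.pi * Complex.I)))
    hg.continuousOn
    (hf.mul continuous_const).neg.continuousOn (fun z hz => (hge z).trans (hFB hz)) hp.2 hq.2
  simp only [hf0 hpu, hf1 hqv, Pi.zero_apply, Pi.one_apply] at h1 h2
  have h3 : (Real.pi * Complex.I : ℂ) = 0 := by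
    simp only [Complex.ofReal_zero, Complex.ofReal_one] at h1 h2
    linear_combination (h1 - h2) / 2
  simp [Real.pi_ne_zero] at h3

/-- A path from top to bottom meets a path from left to right. -/
lemma exists_eq_of_crossing_paths {p q : ℝ → ℂ} (hp : Continuous p) (hq : Continuous q)
    (h1 : ∀ t, 0 < (p 0 - q t).im) (h2 : ∀ t, (p 1 - q t).im < 0)
    (h3 : ∀ s, 0 ≤ (p s - q 0).re) (h4 : ∀ s, (p s - q 1).re ≤ 0) :
    ∃ s t, p s = q t := by
  by_contra! hne
  obtain ⟨g, hg, hge⟩ := exists_continuous_log (f := fun z => p z.re - q z.im)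
    ((hp.comp Complex.continuous_re).sub (hq.comp Complex.continuous_im))
    (fun z => sub_ne_zero.2 (hne _ _))
  have slit1 : ∀ t, p 0 - q t ∈ Complex.slitPlane := fun t => Or.inr (h1 t).ne'
  have slit2 : ∀ t, p 1 - q t ∈ Complex.slitPlane := fun t => Or.inr (h2 t).ne
  have slit3 : ∀ s, p s - q 0 ∈ Complex.slitPlane := fun s =>
    Complex.mem_slitPlane_iff.2 <| or_iff_not_imp_right.2 fun h =>
      (h3 s).lt_of_ne fun h' => hne s 0 <| sub_eq_zero.1 <|
        Complex.ext h'.symm (not_not.1 h)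
  have slit4 : ∀ s, -(p s - q 1) ∈ Complex.slitPlane := fun s =>
    Complex.mem_slitPlane_iff.2 <| or_iff_not_imp_right.2 fun h => by
      have h' : (p s - q 1).im = 0 := by
        have := not_not.1 h
        rwa [Complex.neg_im, neg_eq_zero] at this
      have := (h4 s).lt_of_ne fun h'' => hne s 1 <| sub_eq_zero.1 <| Complex.ext h'' h'
      rw [Complex.neg_re]; linarith
  have along : ∀ (r f : ℝ → ℂ) (_ : Continuous r) (_ : Continuous f)
      (_ : ∀ t, f t ∈ Complex.slitPlane) (_ : ∀ t, Complex.exp (g (r t)) = f t),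
      g (r 0) - Complex.log (f 0) = g (r 1) - Complex.log (f 1) := by
    intro r f hr hf hs he
    exact isPreconnected_univ.sub_eq_sub_of_exp_eq (hg.comp hr).continuousOn
      (hf.clog hs).continuousOn
      (fun t _ => by
        show Complex.exp (g (r t)) = Complex.exp (Complex.log (f t))
        rw [he, Complex.exp_log (Complex.slitPlane_ne_zero (hs t))]) (mem_univ 0) (mem_univ 1)
  have cor : Continuous fun t : ℝ => (t : ℂ) := Complex.continuous_ofReal
  have e1 := along (fun t => t * Complex.I) (fun t => p 0 - q t) (by fun_prop) (by fun_prop)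
    slit1 (fun t => by rw [hge]; simp)
  have e2 := along (fun t => 1 + t * Complex.I) (fun t => p 1 - q t) (by fun_prop) (by fun_prop)
    slit2 (fun t => by rw [hge]; simp)
  have e3 := along (fun s => s) (fun s => p s - q 0) (by fun_prop) (by fun_prop)
    slit3 (fun t => by rw [hge]; simp)
  have e4 := isPreconnected_univ.sub_eq_sub_of_exp_eq (g := fun s : ℝ => g (s + Complex.I))
    (h := fun s : ℝ => Complex.log (-(p s - q 1)) + Real.pi * Complex.I)
    (hg.comp (by fun_prop)).continuousOn
    (((hp.sub continuous_const).neg.clog slit4).add continuous_const).continuousOn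
    (fun s _ => by
      rw [Complex.exp_add, Complex.exp_log (Complex.slitPlane_ne_zero (slit4 s)),
        Complex.exp_pi_mul_I, hge]; simp) (mem_univ 0) (mem_univ 1)
  have c0 : Complex.log (-(p 0 - q 1)) = Complex.log (p 0 - q 1) - Real.pi * Complex.I := by
    rw [Complex.log, Complex.arg_neg_eq_arg_sub_pi_of_im_pos (h1 1), norm_neg, Complex.log]
    push_cast; ring
  have c1 : Complex.log (-(p 1 - q 1)) = Complex.log (p 1 - q 1) + Real.pi * Complex.I := by
    rw [Complex.log, Complex.arg_neg_eq_arg_add_pi_of_im_neg (h2 1), norm_neg, Complex.log]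
    push_cast; ring
  simp only [c0, c1] at e4
  simp only [Complex.ofReal_zero, Complex.ofReal_one, zero_mul, one_mul, add_zero, zero_add]
    at e1 e2 e3 e4
  have h3 : (Real.pi * Complex.I : ℂ) = 0 := by
    linear_combination (e4 - e3 - e2 + e1) / 2
  simp [Real.pi_ne_zero] at h3

/-- A preconnected set meeting a set and its complement meets the frontier. -/
lemma IsPreconnected.inter_frontier_nonempty' {X : Type*} [TopologicalSpace X] {M W : Set X}
    (hM : IsPreconnected M) {x y : X} (hx : x ∈ M) (hy : y ∈ M) (hxW : x ∈ W) (hyW : y ∉ W) :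
    (M ∩ frontier W).Nonempty := by
  by_contra hcon
  rw [not_nonempty_iff_eq_empty] at hcon
  have hcov : M ⊆ interior W ∪ interior Wᶜ := by
    intro z hz
    by_contra h
    rw [mem_union, not_or] at h
    have hf : z ∈ frontier W := by
      rw [frontier, Set.mem_sdiff, closure_eq_compl_interior_compl]
      exact ⟨h.2, h.1⟩
    exact (hcon ▸ (⟨hz, hf⟩ : z ∈ M ∩ frontier W) : z ∈ (∅ : Set X))
  obtain ⟨z, -, hz1, hz2⟩ := hM _ _ isOpen_interior isOpen_interior hcov
    ⟨x, hx, (hcov hx).resolve_right fun h => interior_subset h hxW⟩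
    ⟨y, hy, (hcov hy).resolve_left fun h => hyW (interior_subset h)⟩
  exact interior_subset hz2 (interior_subset hz1)

lemma connectedComponentIn_eq_of_mem_inter {X : Type*} [TopologicalSpace X] {F : Set X}
    {x y z : X} (hx : z ∈ connectedComponentIn F x) (hy : z ∈ connectedComponentIn F y) :
    connectedComponentIn F x = connectedComponentIn F y :=
  (connectedComponentIn_eq hx).trans (connectedComponentIn_eq hy).symm

/-- A component of an open set is relatively closed in it. -/
lemma IsOpen.closure_connectedComponentIn_inter_subset {X : Type*} [TopologicalSpace X]
    [LocallyConnectedSpace X] {U : Set X} (hU : IsOpen U) (x : X) :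
    closure (connectedComponentIn U x) ∩ U ⊆ connectedComponentIn U x := by
  rintro z ⟨hz, hzU⟩
  obtain ⟨w, hw1, hw2⟩ := mem_closure_iff.1 hz _ hU.connectedComponentIn
    (mem_connectedComponentIn hzU)
  rw [connectedComponentIn_eq_of_mem_inter hw2 hw1]
  exact mem_connectedComponentIn hzU

/-- If `W` is a component of the complement of a nonempty connected closed subset `A` of a
connected, locally connected space, then the complement of `W` is connected. -/
lemma isPreconnected_compl_connectedComponentIn_compl {X : Type*} [TopologicalSpace X]
    [LocallyConnectedSpace X] [PreconnectedSpace X] {A : Set X} (hA : IsClosed A)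
    (hAc : IsPreconnected A) {p : X} (hp : p ∈ A) (q : X) :
    IsPreconnected (connectedComponentIn Aᶜ q)ᶜ := by
  have hAW : A ⊆ (connectedComponentIn Aᶜ q)ᶜ :=
    fun z hz hzW => connectedComponentIn_subset _ _ hzW hz
  refine isPreconnected_of_forall p fun x hx => ?_
  by_cases hxA : x ∈ A
  · exact ⟨A, hAW, hp, hxA, hAc⟩
  have hxc : x ∈ connectedComponentIn Aᶜ x := mem_connectedComponentIn hxA
  obtain ⟨z, -, hz⟩ := isPreconnected_univ.inter_frontier_nonempty' (mem_univ x) (mem_univ p)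
    hxc (fun h => connectedComponentIn_subset _ _ h hp)
  have hzA : z ∈ A := by
    by_contra hzA
    have := hA.isOpen_compl.closure_connectedComponentIn_inter_subset x
      ⟨frontier_subset_closure hz, hzA⟩
    rw [hA.isOpen_compl.connectedComponentIn.frontier_eq] at hz
    exact hz.2 this
  have hdisj : closure (connectedComponentIn Aᶜ x) ⊆ (connectedComponentIn Aᶜ q)ᶜ := by
    intro y hy hyW
    obtain ⟨w, hw1, hw2⟩ := mem_closure_iff.1 hy _ hA.isOpen_compl.connectedComponentIn hyW
    apply hx
    rw [← connectedComponentIn_eq_of_mem_inter hw2 hw1]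
    exact hxc
  exact ⟨A ∪ closure (connectedComponentIn Aᶜ x), union_subset hAW hdisj, Or.inl hp,
    Or.inr (subset_closure hxc),
    hAc.union z hzA (frontier_subset_closure hz) isPreconnected_connectedComponentIn.closure⟩

/-- A closed subset of the plane separating two points contains a connected set
separating them. -/
lemma exists_isPreconnected_separating {F : Set ℂ} (hF : IsClosed F) {p q : ℂ} (hp : p ∉ F)
    (hq : q ∉ F) (hpq : q ∉ connectedComponentIn Fᶜ p) :
    ∃ H ⊆ F, IsPreconnected H ∧
      ∀ M : Set ℂ, IsPreconnected M → p ∈ M → q ∈ M → (M ∩ H).Nonempty := by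
  set V := connectedComponentIn Fᶜ p with hV
  have hVo : IsOpen V := hF.isOpen_compl.connectedComponentIn
  have hpV : p ∈ V := mem_connectedComponentIn hp
  have hVcl : closure V ∩ Fᶜ ⊆ V := hF.isOpen_compl.closure_connectedComponentIn_inter_subset p
  set W := connectedComponentIn (closure V)ᶜ q with hW
  have hqA : q ∈ (closure V)ᶜ := fun h => hpq (hVcl ⟨h, hq⟩)
  have hWo : IsOpen W := isClosed_closure.isOpen_compl.connectedComponentIn
  have hWV : W ⊆ (closure V)ᶜ := connectedComponentIn_subset _ _
  have hqW : q ∈ W := mem_connectedComponentIn hqA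
  have hpW : p ∉ W := fun h => hWV h (subset_closure hpV)
  have hfr : frontier W = closure W ∩ Wᶜ := by rw [hWo.frontier_eq]; rfl
  refine ⟨frontier W, ?_, ?_, fun M hM hpM hqM => hM.inter_frontier_nonempty' hqM hpM hqW hpW⟩
  · intro x hx
    rw [hfr] at hx
    by_contra hxF
    have hxA : x ∈ closure V := by
      by_contra hxA
      exact hx.2 (isClosed_closure.isOpen_compl.closure_connectedComponentIn_inter_subset q
        ⟨hx.1, hxA⟩)
    obtain ⟨w, hw1, hw2⟩ := mem_closure_iff.1 hx.1 V hVo (hVcl ⟨hxA, hxF⟩)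
    exact hWV hw2 (subset_closure hw1)
  · rw [hfr]
    refine isPreconnected_inter_of_union_eq_univ isClosed_closure hWo.isClosed_compl
      isPreconnected_connectedComponentIn.closure
      (isPreconnected_compl_connectedComponentIn_compl isClosed_closure
        isPreconnected_connectedComponentIn.closure (subset_closure hpV) q) ?_
    exact eq_univ_of_forall fun z => or_iff_not_imp_right.2 fun h =>
      subset_closure (not_not.1 h)

lemma joinedIn_of_isPreconnected_subset_isOpen {U M : Set ℂ} (hU : IsOpen U)
    (hM : IsPreconnected M) (hMU : M ⊆ U) {x y : ℂ} (hx : x ∈ M) (hy : y ∈ M) :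
    JoinedIn U x y := by
  have h : IsConnected (connectedComponentIn U x) :=
    isConnected_connectedComponentIn_iff.2 (hMU hx)
  exact ((hU.connectedComponentIn.isConnected_iff_isPathConnected.1 h).joinedIn x
    (mem_connectedComponentIn (hMU hx)) y (hM.subset_connectedComponentIn hx hMU hy)).mono
      (connectedComponentIn_subset _ _)

/-- Truncation of the real part to `[a, b]`. -/
def reClamp (a b : ℝ) (z : ℂ) : ℂ := ⟨max a (min b z.re), z.im⟩

lemma continuous_reClamp (a b : ℝ) : Continuous (reClamp a b) := by
  have : reClamp a b = fun z : ℂ => ((max a (min b z.re) : ℝ) : ℂ) + (z.im : ℂ) * Complex.I := by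
    ext z; apply Complex.ext <;> simp [reClamp]
  rw [this]
  fun_prop

lemma reClamp_eq_self {a b : ℝ} {z : ℂ} (h : z.re ∈ Icc a b) : reClamp a b z = z := by
  apply Complex.ext
  · simp [reClamp, min_eq_right h.2, max_eq_right h.1]
  · rfl

/-- In a vertical strip, a connected set from top to bottom meets a compact connected set from
left to right. -/
lemma inter_nonempty_of_crossing {a b : ℝ} (hab : a ≤ b) {γ M : Set ℂ} (hγ : IsCompact γ)
    (hγc : IsPreconnected γ) {l r : ℂ} (hl : l ∈ γ) (hr : r ∈ γ) (hla : l.re ≤ a) (hrb : b ≤ r.re)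
    (hM : IsPreconnected M) (hMs : ∀ z ∈ M, z.re ∈ Icc a b) {t u : ℂ} (ht : t ∈ M) (hu : u ∈ M)
    (htγ : ∀ z ∈ γ, z.im < t.im) (huγ : ∀ z ∈ γ, u.im < z.im) : (M ∩ γ).Nonempty := by
  by_contra hcon
  rw [not_nonempty_iff_eq_empty] at hcon
  have hdis : ∀ z ∈ M, z ∉ γ := fun z hz hzγ => (hcon ▸ ⟨hz, hzγ⟩ : z ∈ (∅ : Set ℂ))
  obtain ⟨p, hp⟩ := joinedIn_of_isPreconnected_subset_isOpen (U := (reClamp a b) ⁻¹' γᶜ)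
    (hγ.isClosed.isOpen_compl.preimage (continuous_reClamp a b)) hM
    (fun z hz => by simpa [reClamp_eq_self (hMs z hz)] using hdis z hz) ht hu
  set P : Set ℂ := range fun s => reClamp a b (p.extend s) with hP
  have hPc : IsClosed P := by
    have : P = (fun s => reClamp a b (p s)) '' univ := by
      rw [image_univ, hP]
      have : (fun s => reClamp a b (p.extend s)) = (fun z => reClamp a b z) ∘ p.extend := rfl
      rw [this, range_comp, p.extend_range, ← range_comp]; rfl
    rw [this]
    exact (isCompact_univ.image ((continuous_reClamp a b).comp p.continuous)).isClosed
  have hPγ : ∀ s, reClamp a b (p.extend s) ∉ γ := fun s => hp (projIcc 0 1 zero_le_one s)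
  obtain ⟨q, hq⟩ := joinedIn_of_isPreconnected_subset_isOpen
    (U := Pᶜ ∩ {z | z.im < t.im} ∩ {z | u.im < z.im})
    ((hPc.isOpen_compl.inter (isOpen_lt Complex.continuous_im continuous_const)).inter
      (isOpen_lt continuous_const Complex.continuous_im)) hγc
    (fun z hz => ⟨⟨by rintro ⟨s, rfl⟩; exact hPγ s hz, htγ z hz⟩, huγ z hz⟩) hl hr
  have hq' : ∀ s, q.extend s ∈ Pᶜ ∩ {z | z.im < t.im} ∩ {z | u.im < z.im} :=
    fun s => hq (projIcc 0 1 zero_le_one s)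
  obtain ⟨s, s', hss⟩ := exists_eq_of_crossing_paths
    (p := fun s => reClamp a b (p.extend s)) (q := q.extend)
    ((continuous_reClamp a b).comp p.continuous_extend) q.continuous_extend
    (fun s => by simpa [reClamp] using (hq' s).1.2) (fun s => by simpa [reClamp] using (hq' s).2)
    (fun s => by simp [reClamp, hla]) (fun s => by simp [reClamp, hrb, hab.trans hrb])
  exact (hq' s').1.1 ⟨s, hss⟩

/-- In a compact Hausdorff space, two closed sets that no component joins are separated by a
clopen set. -/
lemma exists_isClopen_of_disjoint_components {Y : Type*} [TopologicalSpace Y] [CompactSpace Y]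
    [T2Space Y] {L R : Set Y} (hL : IsClosed L) (hR : IsClosed R)
    (h : ∀ x ∈ L, ∀ y ∈ R, y ∉ connectedComponent x) :
    ∃ P : Set Y, IsClopen P ∧ L ⊆ P ∧ Disjoint P R := by
  obtain ⟨C, hC, hLC, hCR⟩ := exists_clopen_of_closed_subset_open
    (Z := ((↑) : Y → ConnectedComponents Y) '' L) (U := (((↑) : Y → ConnectedComponents Y) '' R)ᶜ)
    (hL.isCompact.image ConnectedComponents.continuous_coe).isClosed
    (hR.isCompact.image ConnectedComponents.continuous_coe).isClosed.isOpen_compl (by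
      rintro _ ⟨x, hx, rfl⟩ ⟨y, hy, hxy⟩
      exact h x hx y hy (ConnectedComponents.coe_eq_coe'.1 hxy))
  refine ⟨_, hC.preimage ConnectedComponents.continuous_coe, fun x hx => hLC ⟨x, hx, rfl⟩, ?_⟩
  exact disjoint_left.2 fun y hy hyR => hCR hy ⟨y, hyR, rfl⟩

/-- A compact connected set on which a continuous function takes a value `≤ α` and a value `≥ β`
contains a compact connected subset on which the function takes exactly the values `[α, β]`. -/
lemma exists_crossing_subcontinuum {X : Type*} [TopologicalSpace X] [T2Space X] {D : Set X}
    (hD : IsCompact D) (hDc : IsPreconnected D) {f : X → ℝ} (hf : Continuous f) {α β : ℝ}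
    (hαβ : α < β) {p q : X} (hp : p ∈ D) (hq : q ∈ D) (hpα : f p ≤ α) (hqβ : β ≤ f q) :
    ∃ E ⊆ D, IsCompact E ∧ IsPreconnected E ∧ (∀ z ∈ E, f z ∈ Icc α β) ∧
      (∃ z ∈ E, f z = α) ∧ ∃ z ∈ E, f z = β := by
  set E' : Set X := D ∩ f ⁻¹' Icc α β with hE'
  have hE'c : IsCompact E' := hD.inter_right (isClosed_Icc.preimage hf)
  have hE'D : E' ⊆ D := inter_subset_left
  have : CompactSpace E' := isCompact_iff_compactSpace.1 hE'c
  by_cases hcase : ∃ x y : E', f x = α ∧ f y = β ∧ y ∈ connectedComponent x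
  · obtain ⟨x, y, hx, hy, hxy⟩ := hcase
    refine ⟨(↑) '' connectedComponent x, ?_, ?_, ?_, ?_,
      ⟨x, ⟨x, mem_connectedComponent, rfl⟩, hx⟩, ⟨y, ⟨y, hxy, rfl⟩, hy⟩⟩
    · rintro _ ⟨z, -, rfl⟩
      exact hE'D z.2
    · exact isClosed_connectedComponent.isCompact.image continuous_subtype_val
    · exact isPreconnected_connectedComponent.image _ continuous_subtype_val.continuousOn
    · rintro _ ⟨z, -, rfl⟩
      exact z.2.2
  exfalso
  push Not at hcase
  obtain ⟨P, hP, hLP, hPR⟩ := exists_isClopen_of_disjoint_components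
    (L := {x : E' | f x = α}) (R := {y : E' | f y = β})
    (isClosed_eq (hf.comp continuous_subtype_val) continuous_const)
    (isClosed_eq (hf.comp continuous_subtype_val) continuous_const)
    (fun x hx y hy => hcase x y hx hy)
  have hP1 : IsClosed ((↑) '' P : Set X) :=
    (hP.1.isCompact.image continuous_subtype_val).isClosed
  have hP2 : IsClosed ((↑) '' Pᶜ : Set X) :=
    (hP.compl.1.isCompact.image continuous_subtype_val).isClosed
  obtain ⟨z, hzD, hz1, hz2⟩ := (isPreconnected_closed_iff.1 hDc)
    ((↑) '' P ∪ {z | f z ≤ α}) ((↑) '' Pᶜ ∪ {z | β ≤ f z})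
    (hP1.union (isClosed_le hf continuous_const)) (hP2.union (isClosed_le continuous_const hf))
    (fun z hz => by
      by_cases h1 : f z ≤ α
      · exact Or.inl (Or.inr h1)
      by_cases h2 : β ≤ f z
      · exact Or.inr (Or.inr h2)
      push Not at h1 h2
      by_cases h3 : (⟨z, hz, h1.le, h2.le⟩ : E') ∈ P
      · exact Or.inl (Or.inl ⟨_, h3, rfl⟩)
      · exact Or.inr (Or.inl ⟨_, h3, rfl⟩))
    ⟨p, hp, Or.inr hpα⟩ ⟨q, hq, Or.inr hqβ⟩
  rcases hz1 with ⟨w, hw, rfl⟩ | hz1 <;> rcases hz2 with ⟨w', hw', hww⟩ | hz2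
  · exact hw' (Subtype.ext hww ▸ hw)
  · exact disjoint_left.1 hPR hw (le_antisymm w.2.2.2 hz2)
  · rw [mem_ofPred_eq, ← hww] at hz1
    exact hw' (hLP (le_antisymm hz1 w'.2.2.1))
  · exact absurd (hz2.trans hz1) (not_le.2 hαβ)

lemma isClosed_connectedComponentIn {X : Type*} [TopologicalSpace X] {F : Set X}
    (hF : IsClosed F) (x : X) : IsClosed (connectedComponentIn F x) := by
  by_cases hx : x ∈ F
  · exact isClosed_of_closure_subset (isPreconnected_connectedComponentIn.closure
      |>.subset_connectedComponentIn (subset_closure (mem_connectedComponentIn hx))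
        (closure_minimal (connectedComponentIn_subset _ _) hF))
  · rw [connectedComponentIn_eq_empty hx]
    exact isClosed_empty

lemma isCompact_connectedComponentIn {X : Type*} [TopologicalSpace X] [T2Space X] {K : Set X}
    (hK : IsCompact K) (x : X) : IsCompact (connectedComponentIn K x) :=
  hK.of_isClosed_subset (isClosed_connectedComponentIn hK.isClosed x)
    (connectedComponentIn_subset _ _)

/-- A continuum crossing the vertical strip `a ≤ re z ≤ b`. -/
structure Crosses (a b : ℝ) (γ : Set ℂ) : Prop where
  isCompact : IsCompact γ
  isPreconnected : IsPreconnected γ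
  re_mem : ∀ z ∈ γ, z.re ∈ Icc a b
  left : ∃ z ∈ γ, z.re = a
  right : ∃ z ∈ γ, z.re = b

/-- The subset of the vertical line `re z = a` with imaginary parts in `s`. -/
def vert (a : ℝ) (s : Set ℝ) : Set ℂ := {z | z.re = a ∧ z.im ∈ s}

lemma isPreconnected_vert (a : ℝ) {s : Set ℝ} (hs : IsPreconnected s) :
    IsPreconnected (vert a s) := by
  have : vert a s = (fun y : ℝ => (a : ℂ) + y * Complex.I) '' s := by
    ext z
    constructor
    · rintro ⟨h1, h2⟩
      exact ⟨z.im, h2, by apply Complex.ext <;> simp [h1]⟩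
    · rintro ⟨y, hy, rfl⟩
      exact ⟨by simp, by simpa using hy⟩
  rw [this]
  exact hs.image _ (by fun_prop)

/-- The largest height of a point of `γ` on the line `re z = a`. -/
def topHeight (a : ℝ) (γ : Set ℂ) : ℝ := sSup (Complex.im '' (γ ∩ {z | z.re = a}))

/-- The smallest height of a point of `γ` on the line `re z = a`. -/
def botHeight (a : ℝ) (γ : Set ℂ) : ℝ := sInf (Complex.im '' (γ ∩ {z | z.re = a}))

namespace Crosses

variable {a b : ℝ} {γ Z : Set ℂ}

lemma isCompact_heights (h : Crosses a b γ) : IsCompact (Complex.im '' (γ ∩ {z | z.re = a})) :=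
  (h.isCompact.inter_right (isClosed_eq Complex.continuous_re continuous_const)).image
    Complex.continuous_im

lemma nonempty_heights (h : Crosses a b γ) : (Complex.im '' (γ ∩ {z | z.re = a})).Nonempty := by
  obtain ⟨z, hz, hza⟩ := h.left
  exact ⟨_, z, ⟨hz, hza⟩, rfl⟩

lemma exists_top (h : Crosses a b γ) : ∃ z ∈ γ, z.re = a ∧ z.im = topHeight a γ := by
  obtain ⟨z, ⟨hz, hza⟩, hzt⟩ := h.isCompact_heights.sSup_mem h.nonempty_heights
  exact ⟨z, hz, hza, hzt⟩

lemma exists_bot (h : Crosses a b γ) : ∃ z ∈ γ, z.re = a ∧ z.im = botHeight a γ := by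
  obtain ⟨z, ⟨hz, hza⟩, hzt⟩ := h.isCompact_heights.sInf_mem h.nonempty_heights
  exact ⟨z, hz, hza, hzt⟩

lemma le_top (h : Crosses a b γ) {z : ℂ} (hz : z ∈ γ) (hza : z.re = a) :
    z.im ≤ topHeight a γ :=
  le_csSup h.isCompact_heights.bddAbove ⟨z, ⟨hz, hza⟩, rfl⟩

lemma bot_le (h : Crosses a b γ) {z : ℂ} (hz : z ∈ γ) (hza : z.re = a) :
    botHeight a γ ≤ z.im :=
  csInf_le h.isCompact_heights.bddBelow ⟨z, ⟨hz, hza⟩, rfl⟩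

lemma le (h : Crosses a b γ) : a ≤ b := by
  obtain ⟨z, hz, hza⟩ := h.left
  exact (h.re_mem z hz).1.trans (h.re_mem z hz).2

lemma inter_nonempty (h : Crosses a b γ) {M : Set ℂ} (hM : IsPreconnected M)
    (hMs : ∀ z ∈ M, z.re ∈ Icc a b) {p q : ℂ} (hp : p ∈ M) (hq : q ∈ M) (hpa : p.re = a)
    (hqa : q.re = a) (hpt : topHeight a γ < p.im) (hqb : q.im < botHeight a γ) :
    (M ∩ γ).Nonempty := by
  obtain ⟨l, hl, hla⟩ := h.left
  obtain ⟨r, hr, hrb⟩ := h.right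
  obtain ⟨B, hB⟩ := (h.isCompact.image Complex.continuous_im).bddAbove
  obtain ⟨A, hA⟩ := (h.isCompact.image Complex.continuous_im).bddBelow
  have hB' : ∀ z ∈ γ, z.im ≤ B := fun z hz => hB ⟨z, hz, rfl⟩
  have hA' : ∀ z ∈ γ, A ≤ z.im := fun z hz => hA ⟨z, hz, rfl⟩
  set M' := M ∪ vert a (Ici p.im) ∪ vert a (Iic q.im) with hM'
  have hM'c : IsPreconnected M' :=
    (hM.union p hp (show p ∈ vert a (Ici p.im) from ⟨hpa, self_mem_Ici⟩)
      (isPreconnected_vert a isPreconnected_Ici)).union q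
      (Or.inl hq) ⟨hqa, self_mem_Iic⟩ (isPreconnected_vert a isPreconnected_Iic)
  obtain ⟨z, hz, hzγ⟩ := inter_nonempty_of_crossing h.le h.isCompact h.isPreconnected hl hr
    hla.le hrb.ge hM'c (by
      rintro z ((hz | hz) | hz)
      · exact hMs z hz
      · rw [hz.1]; exact ⟨le_rfl, h.le⟩
      · rw [hz.1]; exact ⟨le_rfl, h.le⟩)
    (t := ⟨a, max p.im (B + 1)⟩) (u := ⟨a, min q.im (A - 1)⟩)
    (Or.inl (Or.inr ⟨rfl, mem_Ici.2 (le_max_left _ _)⟩)) (Or.inr ⟨rfl, mem_Iic.2 (min_le_left _ _)⟩)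
    (fun z hz => lt_of_lt_of_le (by linarith [hB' z hz]) (le_max_right _ _))
    (fun z hz => lt_of_le_of_lt (min_le_right _ _) (by linarith [hA' z hz]))
  rcases hz with (hz | hz) | hz
  · exact ⟨z, hz, hzγ⟩
  · exact absurd (h.le_top hzγ hz.1) (not_le.2 (hpt.trans_le hz.2))
  · exact absurd (h.bot_le hzγ hz.1) (not_le.2 (lt_of_le_of_lt hz.2 hqb))

lemma topHeight_ne (h : Crosses a b γ) (hZ : Crosses a b Z) (hd : Disjoint γ Z) :
    topHeight a γ ≠ topHeight a Z := by
  intro he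
  obtain ⟨z, hz, h1, h2⟩ := h.exists_top
  obtain ⟨w, hw, h3, h4⟩ := hZ.exists_top
  have : z = w := Complex.ext (h1.trans h3.symm) (by rw [h2, h4, he])
  exact disjoint_left.1 hd hz (this ▸ hw)

lemma botHeight_lt (h : Crosses a b γ) (hZ : Crosses a b Z) (hd : Disjoint γ Z)
    (ht : topHeight a γ < topHeight a Z) : botHeight a γ < botHeight a Z := by
  by_contra hcon
  obtain ⟨z, hz, h1, h2⟩ := h.exists_bot
  obtain ⟨w, hw, h3, h4⟩ := hZ.exists_bot
  obtain ⟨t, ht', h5, h6⟩ := hZ.exists_top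
  rcases (not_lt.1 hcon).lt_or_eq with hlt | heq
  · obtain ⟨x, hx, hx'⟩ := h.inter_nonempty hZ.isPreconnected hZ.re_mem ht' hw h5 h3
      (h6 ▸ ht) (h4 ▸ hlt)
    exact disjoint_left.1 hd hx' hx
  · have : z = w := Complex.ext (h1.trans h3.symm) (by rw [h2, h4, heq])
    exact disjoint_left.1 hd hz (this ▸ hw)

/-- Among infinitely many pairwise disjoint crossing continua, one separates two others inside
the strip. -/
lemma exists_between {γ : ℕ → Set ℂ} (h : ∀ n, Crosses a b (γ n))
    (hd : Pairwise fun i j => Disjoint (γ i) (γ j)) :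
    ∃ i j k, i ≠ j ∧ k ≠ j ∧ ∀ M : Set ℂ, IsPreconnected M → (∀ z ∈ M, z.re ∈ Icc a b) →
      (M ∩ γ i).Nonempty → (M ∩ γ k).Nonempty → (M ∩ γ j).Nonempty := by
  have hinj : ∀ i j, i ≠ j → topHeight a (γ i) ≠ topHeight a (γ j) :=
    fun i j hij => (h i).topHeight_ne (h j) (hd hij)
  obtain ⟨i, j, k, hij, hjk⟩ : ∃ i j k, topHeight a (γ i) < topHeight a (γ j) ∧
      topHeight a (γ j) < topHeight a (γ k) := by
    have h01 := hinj 0 1 (by simp)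
    have h02 := hinj 0 2 (by simp)
    have h12 := hinj 1 2 (by simp)
    rcases h01.lt_or_gt with h1 | h1 <;> rcases h02.lt_or_gt with h2 | h2 <;>
      rcases h12.lt_or_gt with h3 | h3
    · exact ⟨0, 1, 2, h1, h3⟩
    · exact ⟨0, 2, 1, h2, h3⟩
    · exact ⟨2, 0, 1, h2, h1⟩
    · exact ⟨2, 0, 1, h2, h1⟩
    · exact ⟨1, 0, 2, h1, h2⟩
    · exact ⟨1, 0, 2, h1, h2⟩
    · exact ⟨1, 2, 0, h3, h2⟩
    · exact ⟨2, 1, 0, h3, h1⟩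
  have hneij : i ≠ j := by rintro rfl; exact lt_irrefl _ hij
  have hnekj : k ≠ j := by rintro rfl; exact lt_irrefl _ hjk
  refine ⟨i, j, k, hneij, hnekj, ?_⟩
  rintro M hM hMs ⟨x, hxM, hxi⟩ ⟨y, hyM, hyk⟩
  obtain ⟨p, hp, hp1, hp2⟩ := (h k).exists_top
  obtain ⟨q, hq, hq1, hq2⟩ := (h i).exists_bot
  obtain ⟨z, hz, hzj⟩ := (h j).inter_nonempty
    ((hM.union x hxM hxi (h i).isPreconnected).union y (Or.inl hyM) hyk (h k).isPreconnected)
    (by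
      rintro z ((hz | hz) | hz)
      exacts [hMs z hz, (h i).re_mem z hz, (h k).re_mem z hz])
    (Or.inr hp) (Or.inl (Or.inr hq)) hp1 hq1 (hp2 ▸ hjk)
    (hq2 ▸ (h i).botHeight_lt (h j) (hd hneij) hij)
  rcases hz with (hz | hz) | hz
  · exact ⟨z, hz, hzj⟩
  · exact absurd hzj (disjoint_left.1 (hd hneij) hz)
  · exact absurd hzj (disjoint_left.1 (hd hnekj) hz)

end Crosses

/-- Truncation of the real part to `[a, b]` and of the imaginary part to `[c, d]`. -/
def boxClamp (a b c d : ℝ) (z : ℂ) : ℂ := ⟨max a (min b z.re), max c (min d z.im)⟩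

lemma continuous_boxClamp (a b c d : ℝ) : Continuous (boxClamp a b c d) := by
  have : boxClamp a b c d = fun z : ℂ => ((max a (min b z.re) : ℝ) : ℂ) +
      ((max c (min d z.im) : ℝ) : ℂ) * Complex.I := by
    ext z; apply Complex.ext <;> simp [boxClamp]
  rw [this]
  fun_prop

lemma boxClamp_eq_self {a b c d : ℝ} {z : ℂ} (h : z.re ∈ Icc a b) (h' : z.im ∈ Icc c d) :
    boxClamp a b c d z = z := by
  apply Complex.ext
  · simp [boxClamp, min_eq_right h.2, max_eq_right h.1]
  · simp [boxClamp, min_eq_right h'.2, max_eq_right h'.1]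

lemma boxClamp_re_mem {a b : ℝ} (c d : ℝ) (hab : a ≤ b) (z : ℂ) :
    (boxClamp a b c d z).re ∈ Icc a b :=
  ⟨le_max_left _ _, max_le hab (min_le_left _ _)⟩

lemma boxClamp_im_mem (a b : ℝ) {c d : ℝ} (hcd : c ≤ d) (z : ℂ) :
    (boxClamp a b c d z).im ∈ Icc c d :=
  ⟨le_max_left _ _, max_le hcd (min_le_left _ _)⟩

/-- If a compact set `K` separates two crossing continua in a rectangle, then some crossing
component of `K` lies between them. -/
lemma Crosses.exists_component_between {a b c d : ℝ} {K : Set ℂ} (hK : IsCompact K)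
    {γ γ' : Set ℂ} (h : Crosses a b γ) (h' : Crosses a b γ') (hc : ∀ z ∈ γ, z.im ∈ Icc c d)
    (hc' : ∀ z ∈ γ', z.im ∈ Icc c d) (hd : Disjoint γ K) (hd' : Disjoint γ' K)
    (hsep : ∀ M : Set ℂ, IsPreconnected M →
      (∀ z ∈ M, z.re ∈ Icc a b ∧ z.im ∈ Icc c d ∧ z ∉ K) →
      (M ∩ γ).Nonempty → ¬ (M ∩ γ').Nonempty) :
    ∃ Z, (∃ x, Z = connectedComponentIn (K ∩ {z | z.re ∈ Icc a b}) x) ∧ Crosses a b Z ∧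
      ¬ (topHeight a γ < topHeight a Z ↔ topHeight a γ' < topHeight a Z) := by
  have hab := h.le
  obtain ⟨p, hp, hpa⟩ := h.left
  obtain ⟨q, hq, hqa⟩ := h'.left
  obtain ⟨p', hp', hpb⟩ := h.right
  obtain ⟨q', hq', hqb⟩ := h'.right
  have hcd : c ≤ d := (hc p hp).1.trans (hc p hp).2
  set r := boxClamp a b c d with hr
  have hrc : Continuous r := continuous_boxClamp a b c d
  have hrγ : ∀ z ∈ γ, z ∉ r ⁻¹' K := fun z hz hzK => disjoint_left.1 hd hz (by
    rwa [mem_preimage, hr, boxClamp_eq_self (h.re_mem z hz) (hc z hz)] at hzK)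
  have hrγ' : ∀ z ∈ γ', z ∉ r ⁻¹' K := fun z hz hzK => disjoint_left.1 hd' hz (by
    rwa [mem_preimage, hr, boxClamp_eq_self (h'.re_mem z hz) (hc' z hz)] at hzK)
  obtain ⟨H, hHF, hHc, hH⟩ := exists_isPreconnected_separating (hK.isClosed.preimage hrc)
    (hrγ p hp) (hrγ' q hq) (by
      intro hpq
      refine hsep (r '' connectedComponentIn (r ⁻¹' K)ᶜ p)
        (isPreconnected_connectedComponentIn.image _ hrc.continuousOn) ?_
        ⟨p, ⟨p, mem_connectedComponentIn (hrγ p hp),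
          boxClamp_eq_self (h.re_mem p hp) (hc p hp)⟩, hp⟩
        ⟨q, ⟨q, hpq, boxClamp_eq_self (h'.re_mem q hq) (hc' q hq)⟩, hq⟩
      rintro _ ⟨z, hz, rfl⟩
      exact ⟨boxClamp_re_mem _ _ hab z, boxClamp_im_mem _ _ hcd z,
        connectedComponentIn_subset _ _ hz⟩)
  have hMH : ∀ L : Set ℂ, IsPreconnected L → (L ∩ γ).Nonempty → (L ∩ γ').Nonempty →
      (L ∩ H).Nonempty := by
    rintro L hL ⟨x, hxL, hx⟩ ⟨y, hyL, hy⟩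
    obtain ⟨z, hz, hzH⟩ := hH (L ∪ γ ∪ γ')
      ((hL.union x hxL hx h.isPreconnected).union y (Or.inl hyL) hy h'.isPreconnected)
      (Or.inl (Or.inr hp)) (Or.inr hq)
    rcases hz with (hz | hz) | hz
    · exact ⟨z, hz, hzH⟩
    · exact absurd (hHF hzH) (hrγ z hz)
    · exact absurd (hHF hzH) (hrγ' z hz)
  obtain ⟨x, hx, hxH⟩ := hMH _ (isPreconnected_vert a isPreconnected_univ)
    ⟨p, ⟨hpa, trivial⟩, hp⟩ ⟨q, ⟨hqa, trivial⟩, hq⟩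
  obtain ⟨y, hy, hyH⟩ := hMH _ (isPreconnected_vert b isPreconnected_univ)
    ⟨p', ⟨hpb, trivial⟩, hp'⟩ ⟨q', ⟨hqb, trivial⟩, hq'⟩
  set T : Set ℂ := K ∩ {z | z.re ∈ Icc a b} with hT
  have hTc : IsCompact T :=
    hK.inter_right (isClosed_Icc.preimage Complex.continuous_re)
  have hHT : r '' H ⊆ T := by
    rintro _ ⟨z, hz, rfl⟩
    exact ⟨hHF hz, boxClamp_re_mem _ _ hab z⟩
  have hHZ : r '' H ⊆ connectedComponentIn T (r x) :=
    (hHc.image _ hrc.continuousOn).subset_connectedComponentIn ⟨x, hxH, rfl⟩ hHT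
  have hZT := connectedComponentIn_subset T (r x)
  have hZ : Crosses a b (connectedComponentIn T (r x)) :=
    { isCompact := isCompact_connectedComponentIn hTc (r x)
      isPreconnected := isPreconnected_connectedComponentIn
      re_mem := fun z hz => (hZT hz).2
      left := ⟨r x, hHZ ⟨x, hxH, rfl⟩, by simp [hr, boxClamp, hx.1, hab]⟩
      right := ⟨r y, hHZ ⟨y, hyH, rfl⟩, by simp [hr, boxClamp, hy.1, hab]⟩ }
  refine ⟨_, ⟨r x, rfl⟩, hZ, ?_⟩
  set Z := connectedComponentIn T (r x)
  have hdZ : Disjoint γ Z := hd.mono_right (hZT.trans inter_subset_left)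
  have hdZ' : Disjoint γ' Z := hd'.mono_right (hZT.trans inter_subset_left)
  have hvert : ∀ s ⊆ Icc c d, IsPreconnected s → (vert a s ∩ γ).Nonempty →
      (vert a s ∩ γ').Nonempty → ∃ z ∈ Z, z.re = a ∧ z.im ∈ s := by
    intro s hs hsc h1 h2
    obtain ⟨z, hz, hzH⟩ := hMH _ (isPreconnected_vert a hsc) h1 h2
    refine ⟨z, ?_, hz⟩
    have : r z = z := boxClamp_eq_self (by rw [hz.1]; exact ⟨le_rfl, hab⟩) (hs hz.2)
    exact this ▸ hHZ ⟨z, hzH, rfl⟩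
  intro hiff
  by_cases h1 : topHeight a γ < topHeight a Z
  · have h2 := hiff.1 h1
    obtain ⟨u, hu, hua, hut⟩ := h.exists_bot
    obtain ⟨v, hv, hva, hvt⟩ := h'.exists_bot
    obtain ⟨z, hz, hza, hzi⟩ := hvert (Iio (botHeight a Z) ∩ Icc c d) inter_subset_right
      (ordConnected_Iio.inter ordConnected_Icc).isPreconnected
      ⟨u, ⟨hua, hut ▸ h.botHeight_lt hZ hdZ h1, hc u hu⟩, hu⟩
      ⟨v, ⟨hva, hvt ▸ h'.botHeight_lt hZ hdZ' h2, hc' v hv⟩, hv⟩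
    exact absurd (hZ.bot_le hz hza) (not_le.2 hzi.1)
  · have h2 := fun h => h1 (hiff.2 h)
    obtain ⟨u, hu, hua, hut⟩ := h.exists_top
    obtain ⟨v, hv, hva, hvt⟩ := h'.exists_top
    obtain ⟨z, hz, hza, hzi⟩ := hvert (Ioi (topHeight a Z) ∩ Icc c d) inter_subset_right
      (ordConnected_Ioi.inter ordConnected_Icc).isPreconnected
      ⟨u, ⟨hua, hut ▸ (not_lt.1 h1).lt_of_ne (h.topHeight_ne hZ hdZ).symm, hc u hu⟩, hu⟩
      ⟨v, ⟨hva, hvt ▸ (not_lt.1 h2).lt_of_ne (h'.topHeight_ne hZ hdZ').symm, hc' v hv⟩, hv⟩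
    exact absurd (hZ.le_top hz hza) (not_le.2 hzi.1)

/-- If a compact set separates infinitely many crossing continua from each other in a rectangle,
then it has infinitely many crossing components. -/
lemma Crosses.infinite_components {a b c d : ℝ} {K : Set ℂ} (hK : IsCompact K)
    {γ : ℕ → Set ℂ} (h : ∀ n, Crosses a b (γ n)) (hc : ∀ n, ∀ z ∈ γ n, z.im ∈ Icc c d)
    (hd : ∀ n, Disjoint (γ n) K)
    (hsep : ∀ i j, i ≠ j → ∀ M : Set ℂ, IsPreconnected M →
      (∀ z ∈ M, z.re ∈ Icc a b ∧ z.im ∈ Icc c d ∧ z ∉ K) →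
      (M ∩ γ i).Nonempty → ¬ (M ∩ γ j).Nonempty) :
    {Z | (∃ x, Z = connectedComponentIn (K ∩ {z | z.re ∈ Icc a b}) x) ∧
      Crosses a b Z}.Infinite := by
  intro hfin
  set 𝓩 := {Z | (∃ x, Z = connectedComponentIn (K ∩ {z | z.re ∈ Icc a b}) x) ∧
      Crosses a b Z}
  have : Finite 𝓩 := hfin
  refine not_injective_infinite_finite
    (fun (n : ℕ) (Z : 𝓩) => topHeight a (γ n) < topHeight a (Z : Set ℂ)) ?_
  intro i j hij
  by_contra hne
  obtain ⟨Z, hZ1, hZ2, hZ3⟩ := Crosses.exists_component_between hK (h i) (h j) (hc i) (hc j)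
    (hd i) (hd j) (hsep i j hne)
  exact hZ3 (iff_of_eq (congrFun hij ⟨Z, hZ1, hZ2⟩))

/-- The sup norm on the plane. -/
def boxNorm (z : ℂ) : ℝ := max |z.re| |z.im|

lemma continuous_boxNorm : Continuous boxNorm := by
  unfold boxNorm; fun_prop

lemma boxNorm_le_norm (z : ℂ) : boxNorm z ≤ ‖z‖ :=
  max_le (Complex.abs_re_le_norm z) (Complex.abs_im_le_norm z)

lemma norm_le_two_mul_boxNorm (z : ℂ) : ‖z‖ ≤ 2 * boxNorm z := by
  have := Complex.norm_le_abs_re_add_abs_im z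
  have h1 : |z.re| ≤ boxNorm z := le_max_left _ _
  have h2 : |z.im| ≤ boxNorm z := le_max_right _ _
  linarith

/-- The isometry `z ↦ I ^ k * (z - ξ)`. -/
def turn (ξ : ℂ) (k : Fin 4) : ℂ ≃ᵢ ℂ :=
  (IsometryEquiv.subRight ξ).trans
    (rotation (⟨Complex.I ^ (k : ℕ), by simp [Submonoid.unitSphere]⟩ : Circle)).toIsometryEquiv

lemma turn_apply (ξ : ℂ) (k : Fin 4) (z : ℂ) : turn ξ k z = Complex.I ^ (k : ℕ) * (z - ξ) := rfl

lemma boxNorm_turn (ξ : ℂ) (k : Fin 4) (z : ℂ) : boxNorm (turn ξ k z) = boxNorm (z - ξ) := by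
  rw [turn_apply]
  generalize z - ξ = w
  fin_cases k <;> simp [boxNorm, pow_succ, max_comm]

lemma exists_turn_re_eq (ξ z : ℂ) : ∃ k, (turn ξ k z).re = boxNorm (z - ξ) := by
  simp only [turn_apply]
  generalize z - ξ = w
  unfold boxNorm
  rcases le_total |w.re| |w.im| with h | h
  · rw [max_eq_right h]
    rcases le_total 0 w.im with h' | h'
    · exact ⟨3, by simp [pow_succ, abs_of_nonneg h']⟩
    · exact ⟨1, by simp [abs_of_nonpos h']⟩
  · rw [max_eq_left h]
    rcases le_total 0 w.re with h' | h'
    · exact ⟨0, by simp [abs_of_nonneg h']⟩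
    · exact ⟨2, by simp [pow_succ, abs_of_nonpos h']⟩

lemma exists_crossing_turn {D : Set ℂ} (hD : IsCompact D) (hDc : IsPreconnected D) {ξ : ℂ}
    {a b : ℝ} (hab : a < b) (h1 : ∃ z ∈ D, boxNorm (z - ξ) ≤ a)
    (h2 : ∃ z ∈ D, b ≤ boxNorm (z - ξ)) :
    ∃ k, ∃ γ ⊆ D, Crosses a b (turn ξ k '' γ) ∧ ∀ z ∈ γ, boxNorm (z - ξ) ≤ b := by
  obtain ⟨p, hp, hpa⟩ := h1
  obtain ⟨q, hq, hqb⟩ := h2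
  obtain ⟨E, hED, hEk, hEc, hE, ⟨p', hp', hpa'⟩, q', hq', hqb'⟩ :=
    exists_crossing_subcontinuum hD hDc (f := fun z => boxNorm (z - ξ))
      (continuous_boxNorm.comp (continuous_id.sub continuous_const)) hab hp hq hpa hqb
  obtain ⟨k, hk⟩ := exists_turn_re_eq ξ q'
  obtain ⟨γ, hγE, hγk, hγc, hγ, ⟨l, hl, hla⟩, r, hr, hrb⟩ :=
    exists_crossing_subcontinuum hEk hEc (f := fun z => (turn ξ k z).re)
      (Complex.continuous_re.comp (turn ξ k).continuous) hab hp' hq'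
      (((le_abs_self _).trans (le_max_left _ _)).trans
        ((boxNorm_turn ξ k p').trans hpa').le) (hk.trans hqb').ge
  refine ⟨k, γ, hγE.trans hED, ⟨hγk.image (turn ξ k).continuous,
    hγc.image _ (turn ξ k).continuous.continuousOn, ?_, ⟨_, ⟨l, hl, rfl⟩, hla⟩,
    ⟨_, ⟨r, hr, rfl⟩, hrb⟩⟩, fun z hz => (hE z (hγE hz)).2⟩
  rintro _ ⟨z, hz, rfl⟩
  exact hγ z hz

/-- Infinitely many continua that cross a square annulus contain infinitely many
continua that cross one of its sides. -/
lemma exists_crossing_family {D : ℕ → Set ℂ} (hD : ∀ n, IsCompact (D n))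
    (hDc : ∀ n, IsPreconnected (D n)) {ξ : ℂ} {a b : ℝ} (hab : a < b)
    (h1 : ∀ n, ∃ z ∈ D n, boxNorm (z - ξ) ≤ a) (h2 : ∀ n, ∃ z ∈ D n, b ≤ boxNorm (z - ξ)) :
    ∃ k, ∃ e : ℕ → ℕ, ∃ γ : ℕ → Set ℂ, Function.Injective e ∧
      (∀ n, γ n ⊆ D (e n)) ∧ (∀ n, Crosses a b (turn ξ k '' γ n)) ∧
      ∀ n, ∀ z ∈ γ n, boxNorm (z - ξ) ≤ b := by
  choose k γ hγ1 hγ2 hγ3 using fun n => exists_crossing_turn (hD n) (hDc n) hab (h1 n) (h2 n)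
  obtain ⟨k₀, hk₀⟩ := Finite.exists_infinite_fiber k
  have hmem : ∀ n, k (Infinite.natEmbedding (k ⁻¹' {k₀}) n) = k₀ := fun n =>
    (Infinite.natEmbedding (k ⁻¹' {k₀}) n).2
  refine ⟨k₀, fun n => Infinite.natEmbedding (k ⁻¹' {k₀}) n,
    fun n => γ (Infinite.natEmbedding (k ⁻¹' {k₀}) n),
    Subtype.val_injective.comp (Infinite.natEmbedding _).injective, fun n => hγ1 _,
    fun n => ?_, fun n => hγ3 _⟩
  have := hγ2 (Infinite.natEmbedding (k ⁻¹' {k₀}) n)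
  rwa [hmem n] at this

/-- A crossing continuum meets every vertical line in the strip. -/
lemma Crosses.exists_re_eq {a b m : ℝ} {γ : Set ℂ} (h : Crosses a b γ) (hm : m ∈ Icc a b) :
    ∃ z ∈ γ, z.re = m := by
  obtain ⟨l, hl, hla⟩ := h.left
  obtain ⟨r, hr, hrb⟩ := h.right
  obtain ⟨z, hz, hzm⟩ := h.isPreconnected.intermediate_value hl hr
    Complex.continuous_re.continuousOn (hla.symm ▸ hrb.symm ▸ hm)
  exact ⟨z, hz, hzm⟩

lemma Crosses.exists_between_image {φ : ℂ ≃ᵢ ℂ} {a b : ℝ} {γ : ℕ → Set ℂ}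
    (h : ∀ n, Crosses a b (φ '' γ n)) (hd : Pairwise fun i j => Disjoint (γ i) (γ j)) :
    ∃ i j k, i ≠ j ∧ k ≠ j ∧ ∀ M : Set ℂ, IsPreconnected M → (∀ z ∈ M, (φ z).re ∈ Icc a b) →
      (M ∩ γ i).Nonempty → (M ∩ γ k).Nonempty → (M ∩ γ j).Nonempty := by
  obtain ⟨i, j, k, hij, hkj, H⟩ := Crosses.exists_between h
    (fun i j hij => (disjoint_image_iff φ.injective).2 (hd hij))
  refine ⟨i, j, k, hij, hkj, fun M hM hMs hi hk => ?_⟩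
  have := H (φ '' M) (hM.image _ φ.continuous.continuousOn)
    (by rintro _ ⟨z, hz, rfl⟩; exact hMs z hz)
    (by rw [← image_inter φ.injective]; exact hi.image _)
    (by rw [← image_inter φ.injective]; exact hk.image _)
  rwa [← image_inter φ.injective, image_nonempty] at this

lemma Crosses.infinite_components_image {φ : ℂ ≃ᵢ ℂ} {a b c d : ℝ} {K : Set ℂ} (hK : IsCompact K)
    {γ : ℕ → Set ℂ} (h : ∀ n, Crosses a b (φ '' γ n))
    (hc : ∀ n, ∀ z ∈ γ n, (φ z).im ∈ Icc c d) (hd : ∀ n, Disjoint (γ n) K)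
    (hsep : ∀ i j, i ≠ j → ∀ M : Set ℂ, IsPreconnected M →
      (∀ z ∈ M, (φ z).re ∈ Icc a b ∧ (φ z).im ∈ Icc c d ∧ z ∉ K) →
      (M ∩ γ i).Nonempty → ¬ (M ∩ γ j).Nonempty) :
    {Z | (∃ x, Z = connectedComponentIn (K ∩ {z | (φ z).re ∈ Icc a b}) x) ∧
      Crosses a b (φ '' Z)}.Infinite := by
  have H := Crosses.infinite_components (hK.image φ.continuous) h (c := c) (d := d)
    (by rintro n _ ⟨z, hz, rfl⟩; exact hc n z hz)
    (fun n => (disjoint_image_iff φ.injective).2 (hd n)) (by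
      intro i j hij M hM hMs hi hj
      refine hsep i j hij (φ ⁻¹' M) (φ.toHomeomorph.isPreconnected_preimage.2 hM) ?_ ?_ ?_
      · exact fun z hz => ⟨(hMs _ hz).1, (hMs _ hz).2.1, fun hzK => (hMs _ hz).2.2 ⟨z, hzK, rfl⟩⟩
      · obtain ⟨_, hz, z, hz', rfl⟩ := hi
        exact ⟨z, hz, hz'⟩
      · obtain ⟨_, hz, z, hz', rfl⟩ := hj
        exact ⟨z, hz, hz'⟩)
  refine (H.image (f := fun Z => φ ⁻¹' Z) φ.surjective.preimage_injective.injOn).mono ?_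
  rintro _ ⟨Z, ⟨⟨x, rfl⟩, hZ⟩, rfl⟩
  have himg : φ '' (K ∩ {z | (φ z).re ∈ Icc a b}) = φ '' K ∩ {z | z.re ∈ Icc a b} := by
    ext w
    constructor
    · rintro ⟨z, ⟨hz, hz'⟩, rfl⟩
      exact ⟨⟨z, hz, rfl⟩, hz'⟩
    · rintro ⟨⟨z, hz, rfl⟩, hz'⟩
      exact ⟨z, ⟨hz, hz'⟩, rfl⟩
  refine ⟨⟨φ.symm x, ?_⟩, by rwa [image_preimage_eq _ φ.surjective]⟩
  obtain ⟨l, hl, -⟩ := hZ.left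
  have hx : x ∈ φ '' K ∩ {z | z.re ∈ Icc a b} := by
    by_contra hx
    rw [connectedComponentIn_eq_empty hx] at hl
    exact hl
  rw [← himg] at hx ⊢
  obtain ⟨y, hy, rfl⟩ := hx
  have := φ.toHomeomorph.image_connectedComponentIn hy
  change φ '' _ = connectedComponentIn (φ '' _) (φ y) at this
  rw [← this, φ.symm_apply_apply]
  exact preimage_image_eq _ φ.injective

/-- If every neighbourhood of `ξ` in `S` carries infinitely many labels, some sequence in `S`
with distinct labels converges to `ξ`. -/
lemma exists_seq_tendsto_of_infinite_image {X β : Type*} [PseudoMetricSpace X] {S : Set X} {ξ : X}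
    {f : X → β} (h : ∀ δ > 0, (f '' (S ∩ ball ξ δ)).Infinite) :
    ∃ y : ℕ → X, (∀ n, y n ∈ S) ∧ Tendsto y atTop (𝓝 ξ) ∧ Function.Injective (f ∘ y) := by
  classical
  obtain ⟨g, hg1, hg2⟩ := exists_seq_of_forall_finset_exists
    (fun p : ℕ × X => p.2 ∈ S ∧ dist p.2 ξ < 1 / ((p.1 : ℝ) + 1))
    (fun p q : ℕ × X => p.1 < q.1 ∧ f p.2 ≠ f q.2) (by
      intro s _
      set N := s.sup Prod.fst + 1
      obtain ⟨_, ⟨y, hy, rfl⟩, hys⟩ := (h (1 / ((N : ℝ) + 1)) (by positivity)).exists_notMem_finset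
        (s.image fun p => f p.2)
      refine ⟨(N, y), ⟨hy.1, hy.2⟩, fun p hp => ⟨?_, fun he => ?_⟩⟩
      · exact Nat.lt_succ_of_le (Finset.le_sup (f := Prod.fst) hp)
      · exact hys (Finset.mem_image.2 ⟨p, hp, he⟩))
  have hmono : StrictMono fun n => (g n).1 := fun m n hmn => (hg2 m n hmn).1
  refine ⟨fun n => (g n).2, fun n => (hg1 n).1, ?_, ?_⟩
  · rw [tendsto_iff_dist_tendsto_zero]
    refine squeeze_zero (fun _ => dist_nonneg) (fun n => (hg1 n).2.le)
      (tendsto_one_div_add_atTop_nhds_zero_nat.comp hmono.tendsto_atTop)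
  · intro m n hmn
    by_contra hne
    rcases Nat.lt_or_gt_of_ne hne with hlt | hlt
    · exact (hg2 m n hlt).2 hmn
    · exact (hg2 n m hlt).2 hmn.symm

lemma LocallySeqAccessible.exists_finite {Ω : Set ℂ} {ξ : ℂ} (h : LocallySeqAccessible Ω ξ)
    {r : ℝ} (hr : 0 < r) :
    ∃ δ > 0, (connectedComponentIn (Ω ∩ ball ξ r) '' (Ω ∩ ball ξ δ)).Finite := by
  by_contra! hcon
  obtain ⟨y, hy, hyξ, hinj⟩ := exists_seq_tendsto_of_infinite_image (S := Ω) (ξ := ξ) hcon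
  obtain ⟨x, hx, hinf⟩ := h r hr y hy hyξ
  obtain ⟨m, hm, n, hn, hmn⟩ := hinf.nontrivial
  exact hmn (hinj (connectedComponentIn_eq_of_mem_inter
    (mem_connectedComponentIn (by
      by_contra hmem
      rw [connectedComponentIn_eq hm, connectedComponentIn_eq_empty hmem] at hm
      exact hm)) hm |>.trans (connectedComponentIn_eq hn)))

lemma exists_seq_of_not_locallySeqAccessible {Ω : Set ℂ} {ξ : ℂ}
    (h : ¬ LocallySeqAccessible Ω ξ) :
    ∃ r > 0, ∃ y : ℕ → ℂ, (∀ n, y n ∈ Ω ∩ ball ξ r) ∧ Tendsto y atTop (𝓝 ξ) ∧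
      Function.Injective fun n => connectedComponentIn (Ω ∩ ball ξ r) (y n) := by
  unfold LocallySeqAccessible at h
  push Not at h
  obtain ⟨r, hr, u, hu, huξ, hfin⟩ := h
  refine ⟨r, hr, exists_seq_tendsto_of_infinite_image
    (f := connectedComponentIn (Ω ∩ ball ξ r)) fun δ hδ hF => ?_⟩
  obtain ⟨N, hN⟩ := eventually_atTop.1
    (huξ.eventually (ball_mem_nhds ξ (lt_min hr hδ)))
  have hmem : ∀ n, u (N + n) ∈ Ω ∩ ball ξ r ∩ ball ξ δ := fun n =>
    have := hN (N + n) (Nat.le_add_right _ _)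
    ⟨⟨hu _, ball_subset_ball (min_le_left _ _) this⟩, ball_subset_ball (min_le_right _ _) this⟩
  have : Finite (connectedComponentIn (Ω ∩ ball ξ r) '' (Ω ∩ ball ξ r ∩ ball ξ δ)) := hF
  obtain ⟨⟨_, x, hx, rfl⟩, hinf⟩ := Finite.exists_infinite_fiber
    (fun n : ℕ => (⟨_, u (N + n), hmem n, rfl⟩ :
      connectedComponentIn (Ω ∩ ball ξ r) '' (Ω ∩ ball ξ r ∩ ball ξ δ)))
  refine (infinite_coe_iff.1 hinf).image (f := fun n => N + n)
    (fun a _ b _ hab => Nat.add_left_cancel hab) ((hfin x hx.1).subset ?_)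
  rintro _ ⟨n, hn, rfl⟩
  have : connectedComponentIn (Ω ∩ ball ξ r) (u (N + n)) =
    connectedComponentIn (Ω ∩ ball ξ r) x := congrArg Subtype.val hn
  exact this ▸ mem_connectedComponentIn (hmem n).1

lemma LocallySeqAccessible.finitelyConnectedAt {Ω : Set ℂ} (hΩ : IsOpen Ω) {ξ : ℂ}
    (h : LocallySeqAccessible Ω ξ) : FinitelyConnectedAt Ω ξ := by
  intro r hr
  obtain ⟨δ, hδ, hfin⟩ := h.exists_finite hr
  set B := Ω ∩ ball ξ r with hB
  have hBo : IsOpen B := hΩ.inter isOpen_ball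
  set ε := min δ r
  set W : Set ℂ := ⋃ y ∈ Ω ∩ ball ξ ε, connectedComponentIn B y with hW
  have hWB : W ⊆ B := iUnion₂_subset fun y _ => connectedComponentIn_subset _ _
  have hUW : (ball ξ ε ∪ W) ∩ Ω = W := by
    refine Subset.antisymm ?_ fun z hz => ⟨Or.inr hz, (hWB hz).1⟩
    rintro z ⟨hz | hz, hzΩ⟩
    · exact mem_biUnion (show z ∈ Ω ∩ ball ξ ε from ⟨hzΩ, hz⟩) (mem_connectedComponentIn
        ⟨hzΩ, ball_subset_ball (min_le_right _ _) hz⟩)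
    · exact hz
  refine ⟨ball ξ ε ∪ W,
    isOpen_ball.union (isOpen_biUnion fun y _ => hBo.connectedComponentIn),
    Or.inl (mem_ball_self (lt_min hδ hr)), union_subset (ball_subset_ball (min_le_right _ _))
      (hWB.trans inter_subset_right), hfin.subset ?_⟩
  rw [hUW]
  rintro _ ⟨y, hy, rfl⟩
  obtain ⟨x, hx, hyx⟩ := mem_iUnion₂.1 hy
  refine ⟨x, ⟨hx.1, ball_subset_ball (min_le_left _ _) hx.2⟩, ?_⟩
  rw [connectedComponentIn_eq hyx]
  refine Subset.antisymm ?_ (connectedComponentIn_mono _ hWB)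
  refine isPreconnected_connectedComponentIn.subset_connectedComponentIn
    (mem_connectedComponentIn (hWB hy)) ?_
  rw [← connectedComponentIn_eq hyx]
  exact subset_biUnion_of_mem (u := fun y => connectedComponentIn B y) hx

lemma propertyS_of_finite {Ω : Set ℂ}
    (h : ∀ ε > 0, ∃ P : Set (Set ℂ), P.Finite ∧
      (∀ N ∈ P, IsConnected N ∧ diam N < ε) ∧ ⋃₀ P = Ω) : PropertyS Ω := by
  intro ε hε
  obtain ⟨F, hF, h1, h2⟩ := h ε hε
  obtain ⟨k, N, -, hN⟩ := hF.fin_param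
  refine ⟨k, N, fun i => h1 _ (hN ▸ mem_range_self i), ?_⟩
  rw [← h2, ← hN, sUnion_range]

lemma propertyS_of_finitelyConnectedAt {Ω : Set ℂ} (hΩ : IsOpen Ω)
    (hb : Bornology.IsBounded Ω) (h : ∀ x ∈ frontier Ω, FinitelyConnectedAt Ω x) :
    PropertyS Ω := by
  refine propertyS_of_finite fun ε hε => ?_
  have hloc : ∀ x ∈ closure Ω, ∃ U : Set ℂ, IsOpen U ∧ x ∈ U ∧ U ⊆ ball x (ε / 3) ∧
      {Q : Set ℂ | ∃ y ∈ U ∩ Ω, Q = connectedComponentIn (U ∩ Ω) y}.Finite := by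
    intro x hx
    by_cases hxΩ : x ∈ Ω
    · obtain ⟨δ, hδ, hball⟩ := Metric.isOpen_iff.1 hΩ x hxΩ
      have hsub : ball x (min δ (ε / 3)) ⊆ Ω :=
        (ball_subset_ball (min_le_left _ _)).trans hball
      refine ⟨ball x (min δ (ε / 3)), isOpen_ball, mem_ball_self (by positivity),
        ball_subset_ball (min_le_right _ _),
        (finite_singleton (ball x (min δ (ε / 3)))).subset ?_⟩
      rw [inter_eq_left.2 hsub]
      rintro _ ⟨y, hy, rfl⟩
      exact (convex_ball x _).isPreconnected.connectedComponentIn hy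
    · exact h x (by rw [hΩ.frontier_eq]; exact ⟨hx, hxΩ⟩) _ (by positivity)
  choose! U hUo hxU hUb hUf using hloc
  obtain ⟨t, htc⟩ := hb.isCompact_closure.elim_nhds_subcover' (fun x _ => U x)
    (fun x hx => (hUo x hx).mem_nhds (hxU x hx))
  refine ⟨⋃ x ∈ t, {Q : Set ℂ | ∃ y ∈ U x ∩ Ω, Q = connectedComponentIn (U x ∩ Ω) y},
    t.finite_toSet.biUnion fun x _ => hUf x x.2, ?_, ?_⟩
  · intro N hN
    obtain ⟨x, -, y, hy, rfl⟩ := mem_iUnion₂.1 hN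
    refine ⟨isConnected_connectedComponentIn_iff.2 hy, ?_⟩
    have h1 : connectedComponentIn (U x ∩ Ω) y ⊆ ball (x : ℂ) (ε / 3) :=
      (connectedComponentIn_subset _ _).trans (inter_subset_left.trans (hUb x x.2))
    calc diam _ ≤ diam (ball (x : ℂ) (ε / 3)) := diam_mono h1 isBounded_ball
      _ ≤ 2 * (ε / 3) := diam_ball (by positivity)
      _ < ε := by linarith
  · refine Subset.antisymm (sUnion_subset ?_) fun z hz => ?_
    · intro N hN
      obtain ⟨x, -, y, hy, rfl⟩ := mem_iUnion₂.1 hN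
      exact (connectedComponentIn_subset _ _).trans inter_subset_right
    · obtain ⟨x, hx, hzx⟩ := mem_iUnion₂.1 (htc (subset_closure hz))
      exact ⟨_, mem_biUnion hx ⟨z, ⟨hzx, hz⟩, rfl⟩, mem_connectedComponentIn ⟨hzx, hz⟩⟩

lemma mazDist_le_diam {Ω E : Set ℂ} (hE : E ⊆ Ω) (hEc : IsConnected E) {x y : ℂ} (hx : x ∈ E)
    (hy : y ∈ E) : mazDist Ω x y ≤ diam E :=
  csInf_le ⟨0, by rintro _ ⟨E, -, rfl⟩; exact diam_nonneg⟩ ⟨E, ⟨hE, hEc, hx, hy⟩, rfl⟩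

lemma PropertyS.mazCompletionCompact {Ω : Set ℂ} (h : PropertyS Ω) : MazCompletionCompact Ω := by
  classical
  intro ε hε
  obtain ⟨k, N, hN, hU⟩ := h ε hε
  choose p hp using fun i => (hN i).1.nonempty
  have hsub : ∀ i, N i ⊆ Ω := fun i => hU ▸ subset_iUnion N i
  refine ⟨Finset.univ.image p, ?_, fun x hx => ?_⟩
  · intro z hz
    obtain ⟨i, -, rfl⟩ := Finset.mem_image.1 hz
    exact hsub i (hp i)
  · rw [← hU] at hx
    obtain ⟨i, hi⟩ := mem_iUnion.1 hx
    exact ⟨p i, Finset.mem_image_of_mem _ (Finset.mem_univ i),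
      (mazDist_le_diam (hsub i) (hN i).1 hi (hp i)).trans_lt (hN i).2⟩

lemma exists_isConnected_of_mazDist_lt {Ω : Set ℂ} (hΩ : IsConnected Ω) {x y : ℂ} {ε : ℝ}
    (hx : x ∈ Ω) (hy : y ∈ Ω) (h : mazDist Ω x y < ε) :
    ∃ E ⊆ Ω, IsConnected E ∧ x ∈ E ∧ y ∈ E ∧ diam E < ε := by
  obtain ⟨_, ⟨E, ⟨h1, h2, h3, h4⟩, rfl⟩, hlt⟩ :=
    exists_lt_of_csInf_lt (Set.Nonempty.image diam
      (⟨Ω, Subset.rfl, hΩ, hx, hy⟩ :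
        {E : Set ℂ | E ⊆ Ω ∧ IsConnected E ∧ x ∈ E ∧ y ∈ E}.Nonempty)) h
  exact ⟨E, h1, h2, h3, h4, hlt⟩

lemma MazCompletionCompact.locallySeqAccessible {Ω : Set ℂ} (hΩ : IsConnected Ω)
    (hb : Bornology.IsBounded Ω) (h : MazCompletionCompact Ω) (ξ : ℂ) :
    LocallySeqAccessible Ω ξ := by
  intro r hr u hu huξ
  obtain ⟨F, hFΩ, hF⟩ := h (r / 4) (by positivity)
  obtain ⟨N, hN⟩ := eventually_atTop.1 (huξ.eventually (ball_mem_nhds ξ (half_pos hr)))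
  choose y hyF hy using fun n => hF (u (N + n)) (hu _)
  obtain ⟨y₀, hinf⟩ := Finite.exists_infinite_fiber (fun n => (⟨y n, hyF n⟩ : F))
  have hinf := infinite_coe_iff.1 hinf
  have key : ∀ n ∈ (fun n => (⟨y n, hyF n⟩ : F)) ⁻¹' {y₀},
      (y₀ : ℂ) ∈ Ω ∩ ball ξ r ∧ u (N + n) ∈ connectedComponentIn (Ω ∩ ball ξ r) y₀ := by
    intro n hn
    have hn' : y n = y₀ := congrArg Subtype.val hn
    obtain ⟨E, hEΩ, hEc, h1, h2, hd⟩ := exists_isConnected_of_mazDist_lt hΩ (hu _)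
      (hFΩ (hyF n)) (hy n)
    rw [hn'] at h2
    have hsub : E ⊆ Ω ∩ ball ξ r := fun z hz => by
      refine ⟨hEΩ hz, ?_⟩
      have h3 := dist_le_diam_of_mem (hb.subset hEΩ) hz h1
      have h4 := mem_ball.1 (hN (N + n) (Nat.le_add_right _ _))
      have := dist_triangle z (u (N + n)) ξ
      rw [mem_ball]
      linarith
    exact ⟨hsub h2, hEc.isPreconnected.subset_connectedComponentIn h2 hsub h1⟩
  obtain ⟨n₀, hn₀⟩ := hinf.nonempty
  refine ⟨y₀, (key n₀ hn₀).1, (hinf.image (f := fun n => N + n)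
    (fun a _ b _ hab => Nat.add_left_cancel hab)).mono ?_⟩
  rintro _ ⟨n, hn, rfl⟩
  exact (key n hn).2

lemma disjoint_connectedComponentIn_of_ne {X : Type*} [TopologicalSpace X] {F : Set X} {x y : X}
    (h : connectedComponentIn F x ≠ connectedComponentIn F y) :
    Disjoint (connectedComponentIn F x) (connectedComponentIn F y) :=
  disjoint_left.2 fun _ hz hw => h (connectedComponentIn_eq_of_mem_inter hz hw)

/-- Boundary bumping for sublevel sets. -/
lemma exists_mem_connectedComponentIn_eq {X : Type*} [TopologicalSpace X] [T2Space X] {D : Set X}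
    (hD : IsCompact D) (hDc : IsPreconnected D) {f : X → ℝ} (hf : Continuous f) {β : ℝ}
    {p q : X} (hp : p ∈ D) (hq : q ∈ D) (hpβ : f p ≤ β) (hqβ : β ≤ f q) :
    ∃ z ∈ connectedComponentIn (D ∩ {z | f z ≤ β}) p, f z = β := by
  set T := D ∩ {z | f z ≤ β} with hT
  have hTc : IsCompact T := hD.inter_right (isClosed_le hf continuous_const)
  have : CompactSpace T := isCompact_iff_compactSpace.1 hTc
  have hpT : p ∈ T := ⟨hp, hpβ⟩
  rw [connectedComponentIn_eq_image hpT]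
  by_contra! hcon
  obtain ⟨P, hP, hLP, hPR⟩ := exists_isClopen_of_disjoint_components
    (L := {(⟨p, hpT⟩ : T)}) (R := {y : T | f y = β}) isClosed_singleton
    (isClosed_eq (hf.comp continuous_subtype_val) continuous_const)
    (fun x hx y hy hxy => hcon y ⟨y, by rwa [mem_singleton_iff.1 hx] at hxy, rfl⟩ hy)
  have hP1 : IsClosed ((↑) '' P : Set X) :=
    (hP.1.isCompact.image continuous_subtype_val).isClosed
  have hP2 : IsClosed ((↑) '' Pᶜ : Set X) :=
    (hP.compl.1.isCompact.image continuous_subtype_val).isClosed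
  obtain ⟨z, hzD, ⟨w, hw, rfl⟩, hz2⟩ := (isPreconnected_closed_iff.1 hDc)
    ((↑) '' P) ((↑) '' Pᶜ ∪ {z | β ≤ f z}) hP1
    (hP2.union (isClosed_le continuous_const hf))
    (fun z hz => by
      by_cases h2 : β ≤ f z
      · exact Or.inr (Or.inr h2)
      push Not at h2
      by_cases h3 : (⟨z, hz, h2.le⟩ : T) ∈ P
      · exact Or.inl ⟨_, h3, rfl⟩
      · exact Or.inr (Or.inl ⟨_, h3, rfl⟩))
    ⟨p, hp, ⟨p, hpT⟩, hLP rfl, rfl⟩ ⟨q, hq, Or.inr hqβ⟩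
  rcases hz2 with ⟨w', hw', hww⟩ | hz2
  · exact hw' (Subtype.ext hww ▸ hw)
  · exact disjoint_left.1 hPR hw (le_antisymm w.2.2 hz2)

lemma abs_re_sub_re_le_dist (φ : ℂ ≃ᵢ ℂ) (z w : ℂ) : |(φ z).re - (φ w).re| ≤ dist z w := by
  rw [← φ.dist_eq, dist_eq_norm, ← Complex.sub_re]
  exact Complex.abs_re_le_norm _

lemma re_mem_Icc_of_dist_le (φ : ℂ ≃ᵢ ℂ) {a b : ℝ} {z w : ℂ} (hw : (φ w).re = (a + b) / 2)
    (h : dist z w ≤ (b - a) / 2) : (φ z).re ∈ Icc a b := by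
  have := abs_le.1 ((abs_re_sub_re_le_dist φ z w).trans h)
  rw [hw] at this
  exact ⟨by linarith [this.1], by linarith [this.2]⟩

/-- The frontier of a bounded set with property S does not contain infinitely many
disjoint continua crossing a square annulus. -/
lemma PropertyS.not_crossing {Ω : Set ℂ} (hS : PropertyS Ω) (hΩ : IsOpen Ω)
    (hb : Bornology.IsBounded Ω) {D : ℕ → Set ℂ} (hD : ∀ n, IsCompact (D n))
    (hDc : ∀ n, IsPreconnected (D n)) (hDΩ : ∀ n, D n ⊆ frontier Ω)
    (hd : Pairwise fun i j => Disjoint (D i) (D j)) {ξ : ℂ} {a b : ℝ} (hab : a < b)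
    (h1 : ∀ n, ∃ z ∈ D n, boxNorm (z - ξ) ≤ a) (h2 : ∀ n, ∃ z ∈ D n, b ≤ boxNorm (z - ξ)) :
    False := by
  obtain ⟨k, e, γ, he, hγD, hγ, -⟩ := exists_crossing_family hD hDc hab h1 h2
  set φ := turn ξ k
  have hp : ∀ n, ∃ p ∈ γ n, (φ p).re = (a + b) / 2 := by
    intro n
    obtain ⟨_, ⟨p, hp, rfl⟩, hpm⟩ := (hγ n).exists_re_eq (m := (a + b) / 2)
      ⟨by linarith, by linarith⟩
    exact ⟨p, hp, hpm⟩
  choose p hpγ hpm using hp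
  have hγΩ : ∀ n, γ n ⊆ frontier Ω := fun n => (hγD n).trans (hDΩ _)
  obtain ⟨K, N, hN, hU⟩ := hS ((b - a) / 2) (by linarith)
  have hNΩ : ∀ i, N i ⊆ Ω := fun i => hU ▸ subset_iUnion N i
  have hcl : ∀ n, ∃ i, p n ∈ closure (N i) := by
    intro n
    have := frontier_subset_closure (hγΩ n (hpγ n))
    rw [← hU, closure_iUnion_of_finite] at this
    exact mem_iUnion.1 this
  choose c hc using hcl
  obtain ⟨i₀, hi₀⟩ := Finite.exists_infinite_fiber c
  set σ : ℕ → ℕ := fun n => Infinite.natEmbedding (c ⁻¹' {i₀}) n with hσ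
  have hσi : Function.Injective σ :=
    Subtype.val_injective.comp (Infinite.natEmbedding _).injective
  have hcσ : ∀ n, p (σ n) ∈ closure (N i₀) := fun n => by
    have : c (σ n) = i₀ := (Infinite.natEmbedding (c ⁻¹' {i₀}) n).2
    exact this ▸ hc (σ n)
  have hγd : Pairwise fun i j => Disjoint (γ (σ i)) (γ (σ j)) := fun i j hij =>
    (hd (fun h => hij (hσi (he h)))).mono (hγD _) (hγD _)
  obtain ⟨i, j, k, hij, hkj, H⟩ := Crosses.exists_between_image (fun n => hγ (σ n)) hγd
  obtain ⟨z, hzM, hzj⟩ := H (N i₀ ∪ {p (σ i), p (σ k)})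
    ((hN i₀).1.isPreconnected.subset_closure subset_union_left (union_subset subset_closure
      (by rintro _ (rfl | rfl); exacts [hcσ i, hcσ k])))
    (fun z hz => re_mem_Icc_of_dist_le φ (hpm (σ i)) (by
      have hz' : z ∈ closure (N i₀) := by
        rcases hz with hz | rfl | rfl
        exacts [subset_closure hz, hcσ i, hcσ k]
      refine (dist_le_diam_of_mem (hb.subset (hNΩ i₀)).closure hz' (hcσ i)).trans ?_
      rw [diam_closure]
      exact (hN i₀).2.le))
    ⟨p (σ i), Or.inr (Or.inl rfl), hpγ _⟩ ⟨p (σ k), Or.inr (Or.inr rfl), hpγ _⟩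
  rcases hzM with hz | rfl | rfl
  · have := hγΩ _ hzj
    rw [hΩ.frontier_eq] at this
    exact this.2 (hNΩ i₀ hz)
  · exact disjoint_left.1 (hγd hij) (hpγ _) hzj
  · exact disjoint_left.1 (hγd hkj) (hpγ _) hzj

lemma exists_seq_tendsto_of_infinite_image_ball {X β : Type*} [PseudoMetricSpace X] {S : Set X}
    {ξ : X} {f : X → β} (h : ∀ δ > 0, (f '' (S ∩ ball ξ δ)).Infinite) {ε : ℝ} (hε : 0 < ε) :
    ∃ y : ℕ → X, (∀ n, y n ∈ S ∧ dist (y n) ξ < ε) ∧ Function.Injective (f ∘ y) := by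
  obtain ⟨y, hy, -, hinj⟩ := exists_seq_tendsto_of_infinite_image (S := S ∩ ball ξ ε) (ξ := ξ)
    (f := f) (fun δ hδ => (h (min ε δ) (lt_min hε hδ)).mono (image_mono fun z hz =>
      ⟨⟨hz.1, ball_subset_ball (min_le_left _ _) hz.2⟩,
        ball_subset_ball (min_le_right _ _) hz.2⟩))
  exact ⟨y, hy, hinj⟩

lemma IsCompact.exists_infinite_image_ball {X β : Type*} [PseudoMetricSpace X] {K S : Set X}
    (hK : IsCompact K) (hS : S ⊆ K) {f : X → β} (h : (f '' S).Infinite) :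
    ∃ x ∈ K, ∀ δ > 0, (f '' (S ∩ ball x δ)).Infinite := by
  by_contra! hcon
  choose! δ hδ hfin using hcon
  obtain ⟨t, htK, ht⟩ := hK.elim_nhds_subcover (fun x => ball x (δ x))
    (fun x hx => ball_mem_nhds x (hδ x hx))
  refine h ((t.finite_toSet.biUnion fun x hx =>
    not_infinite.1 (not_not.2 (hfin x (htK x hx)))).subset ?_)
  rintro _ ⟨z, hz, rfl⟩
  obtain ⟨x, hx, hzx⟩ := mem_iUnion₂.1 (ht (hS hz))
  exact mem_biUnion hx ⟨z, ⟨hz, hzx⟩, rfl⟩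

lemma PropertyS.finite_large_components {Ω : Set ℂ} (hS : PropertyS Ω) (hΩ : IsOpen Ω)
    (hb : Bornology.IsBounded Ω) (hK : IsCompact (frontier Ω)) {C : ℝ} (hC : 0 < C) :
    {Q : Set ℂ | (∃ x ∈ frontier Ω, Q = connectedComponentIn (frontier Ω) x) ∧
      C < diam Q}.Finite := by
  by_contra hinf
  set K := frontier Ω with hKdef
  have himg : {Q : Set ℂ | (∃ x ∈ K, Q = connectedComponentIn K x) ∧ C < diam Q} =
      connectedComponentIn K '' {x | x ∈ K ∧ C < diam (connectedComponentIn K x)} := by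
    ext Q
    constructor
    · rintro ⟨⟨x, hx, rfl⟩, hd⟩
      exact ⟨x, ⟨hx, hd⟩, rfl⟩
    · rintro ⟨x, ⟨hx, hd⟩, rfl⟩
      exact ⟨⟨x, hx, rfl⟩, hd⟩
  rw [himg] at hinf
  obtain ⟨x, hx, hxinf⟩ := hK.exists_infinite_image_ball (fun z hz => hz.1) hinf
  obtain ⟨y, hy, hinj⟩ := exists_seq_tendsto_of_infinite_image_ball hxinf
    (show 0 < C / 16 by positivity)
  refine hS.not_crossing hΩ hb (D := fun n => connectedComponentIn K (y n)) (ξ := x)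
    (a := C / 16) (b := C / 8) (fun n => isCompact_connectedComponentIn hK _)
    (fun n => isPreconnected_connectedComponentIn) (fun n => connectedComponentIn_subset _ _)
    (fun i j hij => disjoint_connectedComponentIn_of_ne (hinj.ne hij)) (by linarith) ?_ ?_
  · refine fun n => ⟨y n, mem_connectedComponentIn (hy n).1.1, ?_⟩
    exact (boxNorm_le_norm _).trans (dist_eq_norm (y n) x ▸ (hy n).2.le)
  · intro n
    by_contra! hcon
    have hsub : connectedComponentIn K (y n) ⊆ closedBall x (C / 4) := fun z hz => by
      rw [mem_closedBall, dist_eq_norm]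
      linarith [norm_le_two_mul_boxNorm (z - x), hcon z hz]
    have := (diam_mono hsub isBounded_closedBall).trans (diam_closedBall (by positivity))
    linarith [(hy n).1.2]

lemma PropertyS.locallyConnectedSpace {Ω : Set ℂ} (hS : PropertyS Ω) (hΩ : IsOpen Ω)
    (hb : Bornology.IsBounded Ω) {Q : Set ℂ} (hQ : IsCompact Q) (hQc : IsPreconnected Q)
    (hQΩ : Q ⊆ frontier Ω) : LocallyConnectedSpace Q := by
  rw [locallyConnectedSpace_iff_connected_subsets]
  rintro ⟨x, hx⟩ U hU
  obtain ⟨ρ, hρ, hρU⟩ := Metric.mem_nhds_iff.1 hU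
  set b := ρ / 3 with hb'
  have hbpos : 0 < b := by positivity
  set T := Q ∩ {z | boxNorm (z - x) ≤ b} with hT
  have hfc : Continuous fun z => boxNorm (z - x) :=
    continuous_boxNorm.comp (continuous_id.sub continuous_const)
  have hTc : IsCompact T := hQ.inter_right (isClosed_le hfc continuous_const)
  have hTQ : T ⊆ Q := inter_subset_left
  have hN : ∀ z, boxNorm (z - x) ≤ dist z x := fun z => dist_eq_norm z x ▸ boxNorm_le_norm _
  have hxT : x ∈ T := ⟨hx, (hN x).trans (by simp [hbpos.le])⟩
  refine ⟨(↑) ⁻¹' connectedComponentIn T x, ?_, ?_, ?_⟩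
  · by_contra hnhds
    have hinf : ∀ δ > 0, (connectedComponentIn T '' (Q ∩ ball x δ)).Infinite := by
      intro δ hδ hfin
      apply hnhds
      set 𝓕 := connectedComponentIn T '' (Q ∩ ball x δ) \ {connectedComponentIn T x} with h𝓕
      have hclosed : IsClosed (⋃₀ 𝓕) := by
        rw [sUnion_eq_biUnion]
        refine Set.Finite.isClosed_biUnion (hfin.subset Set.sdiff_subset) ?_
        rintro _ ⟨⟨y, -, rfl⟩, -⟩
        exact isClosed_connectedComponentIn hTc.isClosed y
      have hx𝓕 : x ∉ ⋃₀ 𝓕 := by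
        rintro ⟨_, ⟨⟨y, -, rfl⟩, hne⟩, hxy⟩
        exact hne (connectedComponentIn_eq hxy)
      have hW : (⋃₀ 𝓕)ᶜ ∩ ball x (min δ b) ∈ 𝓝 x :=
        inter_mem (hclosed.isOpen_compl.mem_nhds hx𝓕) (ball_mem_nhds _ (lt_min hδ hbpos))
      refine mem_of_superset (continuous_subtype_val.continuousAt.preimage_mem_nhds hW) ?_
      rintro ⟨z, hz⟩ ⟨hz1, hz2⟩
      have hzT : z ∈ T := ⟨hz, (hN z).trans (hz2.le.trans (min_le_right _ _))⟩
      by_contra hzx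
      refine hz1 ⟨connectedComponentIn T z, ⟨⟨z, ⟨hz, ball_subset_ball (min_le_left _ _) hz2⟩, rfl⟩,
        fun he => hzx ?_⟩, mem_connectedComponentIn hzT⟩
      rw [mem_preimage, ← mem_singleton_iff.1 he]
      exact mem_connectedComponentIn hzT
    obtain ⟨y, hy, hinj⟩ := exists_seq_tendsto_of_infinite_image_ball hinf (half_pos hbpos)
    have hyT : ∀ n, y n ∈ T := fun n => ⟨(hy n).1, (hN _).trans (by linarith [(hy n).2])⟩
    have hq : ∃ q ∈ Q, b ≤ boxNorm (q - x) := by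
      by_contra! hcon
      have hTQ' : T = Q := inter_eq_left.2 fun z hz => (hcon z hz).le
      refine zero_ne_one (hinj (a₁ := 0) (a₂ := 1) ?_)
      simp only [Function.comp, hTQ', hQc.connectedComponentIn (hy _).1]
    obtain ⟨q, hq, hqb⟩ := hq
    refine hS.not_crossing hΩ hb (D := fun n => connectedComponentIn T (y n)) (ξ := x)
      (a := b / 2) (b := b) (fun n => isCompact_connectedComponentIn hTc _)
      (fun n => isPreconnected_connectedComponentIn)
      (fun n => (connectedComponentIn_subset _ _).trans (hTQ.trans hQΩ))
      (fun i j hij => disjoint_connectedComponentIn_of_ne (hinj.ne hij)) (by linarith)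
      (fun n => ⟨y n, mem_connectedComponentIn (hyT n), (hN _).trans (hy n).2.le⟩) fun n => ?_
    obtain ⟨z, hz, hzb⟩ := exists_mem_connectedComponentIn_eq hQ hQc hfc (hy n).1 hq
      (hyT n).2 hqb
    exact ⟨z, hz, hzb.ge⟩
  · rw [← IsInducing.subtypeVal.isPreconnected_image, Subtype.image_preimage_coe,
      inter_eq_right.2 ((connectedComponentIn_subset _ _).trans hTQ)]
    exact isPreconnected_connectedComponentIn
  · rintro ⟨z, hz⟩ hzx
    refine hρU ?_
    have := (connectedComponentIn_subset _ _ hzx).2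
    rw [mem_ball, Subtype.dist_eq, dist_eq_norm]
    have h2 := norm_le_two_mul_boxNorm (z - x)
    have h3 : boxNorm (z - x) ≤ b := this
    change ‖z - x‖ < ρ
    linarith

lemma PropertyS.isPeanoCompactum_frontier {Ω : Set ℂ} (hS : PropertyS Ω) (hΩ : IsOpen Ω)
    (hb : Bornology.IsBounded Ω) : IsPeanoCompactum (frontier Ω) := by
  have hK : IsCompact (frontier Ω) :=
    hb.isCompact_closure.of_isClosed_subset isClosed_frontier frontier_subset_closure
  exact ⟨hK, fun x _ => hS.locallyConnectedSpace hΩ hb (isCompact_connectedComponentIn hK x)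
    isPreconnected_connectedComponentIn (connectedComponentIn_subset _ _),
    fun C hC => hS.finite_large_components hΩ hb hK hC⟩

/-- If `Ω` is not locally sequentially accessible at `ξ`, then infinitely many components of
`Ω ∩ ball ξ r` contain continua crossing a common quarter of a square annulus about `ξ`. -/
lemma exists_crosses_of_not_locallySeqAccessible {Ω : Set ℂ} (hΩ : IsOpen Ω)
    (hc : IsPreconnected Ω) {ξ : ℂ} (h : ¬ LocallySeqAccessible Ω ξ) :
    ∃ r > 0, ∃ k, ∃ y : ℕ → ℂ, ∃ γ : ℕ → Set ℂ,
      (Function.Injective fun n => connectedComponentIn (Ω ∩ ball ξ r) (y n)) ∧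
      (∀ n, γ n ⊆ connectedComponentIn (Ω ∩ ball ξ r) (y n)) ∧
      (∀ n, Crosses (r / 8) (r / 4) (turn ξ k '' γ n)) ∧
      ∀ n, ∀ z ∈ γ n, boxNorm (z - ξ) ≤ r / 4 := by
  obtain ⟨r, hr, y, hy, hlim, hinj⟩ := exists_seq_of_not_locallySeqAccessible h
  have hO : IsOpen (Ω ∩ ball ξ r) := hΩ.inter isOpen_ball
  obtain ⟨N, hN⟩ :=
    (hlim.eventually (ball_mem_nhds ξ (by positivity : 0 < r / 8))).exists_forall_of_atTop
  have hinj' : Function.Injective fun n => connectedComponentIn (Ω ∩ ball ξ r) (y (n + N)) :=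
    hinj.comp (add_left_injective N)
  have hfar : ∀ n, ∃ q ∈ connectedComponentIn (Ω ∩ ball ξ r) (y (n + N)),
      r / 4 ≤ boxNorm (q - ξ) := by
    intro n
    by_contra! hcon
    have hne : y (n + 1 + N) ∉ connectedComponentIn (Ω ∩ ball ξ r) (y (n + N)) := fun hmem => by
      have := hinj' (connectedComponentIn_eq hmem)
      omega
    obtain ⟨p, hpΩ, hpf⟩ := hc.inter_frontier_nonempty' (hy (n + N)).1 (hy (n + 1 + N)).1
      (mem_connectedComponentIn (hy (n + N))) hne
    rw [hO.connectedComponentIn.frontier_eq] at hpf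
    have hpb : boxNorm (p - ξ) ≤ r / 4 :=
      closure_minimal (t := {z | boxNorm (z - ξ) ≤ r / 4}) (fun z hz => (hcon z hz).le)
        (isClosed_le (continuous_boxNorm.comp (continuous_id.sub continuous_const))
          continuous_const) hpf.1
    refine hpf.2 (hO.closure_connectedComponentIn_inter_subset _ ⟨hpf.1, hpΩ, ?_⟩)
    rw [mem_ball, dist_eq_norm]
    linarith [norm_le_two_mul_boxNorm (p - ξ)]
  choose q hq hqb using hfar
  have hJ : ∀ n, JoinedIn (connectedComponentIn (Ω ∩ ball ξ r) (y (n + N))) (y (n + N)) (q n) :=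
    fun n => joinedIn_of_isPreconnected_subset_isOpen hO.connectedComponentIn
      isPreconnected_connectedComponentIn Subset.rfl (mem_connectedComponentIn (hy _)) (hq n)
  obtain ⟨k, e, γ, he, hγD, hγ, hγb⟩ := exists_crossing_family (ξ := ξ)
    (D := fun n => range (hJ n).somePath) (a := r / 8) (b := r / 4)
    (fun n => isCompact_range (hJ n).somePath.continuous)
    (fun n => isPreconnected_range (hJ n).somePath.continuous) (by linarith)
    (fun n => ⟨y (n + N), ⟨0, (hJ n).somePath.source⟩, (boxNorm_le_norm _).trans <| by
      have := hN (n + N) (by omega)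
      rw [← dist_eq_norm]
      exact this.le⟩)
    (fun n => ⟨q n, ⟨1, (hJ n).somePath.target⟩, hqb n⟩)
  refine ⟨r, hr, k, fun n => y (e n + N), γ, hinj'.comp he, fun n z hz => ?_, hγ, hγb⟩
  obtain ⟨t, rfl⟩ := hγD n hz
  exact (hJ (e n)).somePath_mem t

/-- The part of a Peano compactum made of components of diameter greater than `ε` is covered by
finitely many connected subsets of diameter less than `ε`. -/
lemma IsPeanoCompactum.exists_finite_cover {K : Set ℂ} (hK : IsPeanoCompactum K) {ε : ℝ}
    (hε : 0 < ε) : ∃ S : Set (Set ℂ), S.Finite ∧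
      (∀ P ∈ S, IsPreconnected P ∧ P ⊆ K ∧ Bornology.IsBounded P ∧ diam P < ε) ∧
      ∀ x ∈ K, ε < diam (connectedComponentIn K x) → ∃ P ∈ S, x ∈ P := by
  obtain ⟨hKc, hloc, hfin⟩ := hK
  have key : ∀ x ∈ K, ∃ S : Set (Set ℂ), S.Finite ∧
      (∀ P ∈ S, IsPreconnected P ∧ P ⊆ K ∧ Bornology.IsBounded P ∧ diam P < ε) ∧
      ∀ z ∈ connectedComponentIn K x, ∃ P ∈ S, z ∈ P := by
    intro x hx
    have hlc := hloc x hx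
    have hQ : IsCompact (connectedComponentIn K x) := isCompact_connectedComponentIn hKc x
    have := isCompact_iff_compactSpace.1 hQ
    have hN : ∀ q : connectedComponentIn K x, ∃ V ∈ 𝓝 q, IsPreconnected V ∧
        V ⊆ ball q (ε / 3) := by
      intro q
      obtain ⟨V, ⟨hV1, hV2⟩, hV3⟩ := (locallyConnectedSpace_iff_connected_basis.1 hlc q).mem_iff.1
        (ball_mem_nhds q (by positivity : 0 < ε / 3))
      exact ⟨V, hV1, hV2, hV3⟩
    choose V hV1 hV2 hV3 using hN
    obtain ⟨t, ht⟩ := finite_cover_nhds hV1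
    refine ⟨(fun q => (↑) '' V q) '' (t : Set _), t.finite_toSet.image _, ?_, ?_⟩
    · rintro _ ⟨q, -, rfl⟩
      have hsub : Subtype.val '' V q ⊆ ball (q : ℂ) (ε / 3) := by
        rintro _ ⟨z, hz, rfl⟩
        exact hV3 q hz
      refine ⟨(hV2 q).image _ continuous_subtype_val.continuousOn, ?_,
        isBounded_ball.subset hsub, ?_⟩
      · rintro _ ⟨z, -, rfl⟩
        exact connectedComponentIn_subset _ _ z.2
      · calc diam (Subtype.val '' V q)
          _ ≤ diam (ball (q : ℂ) (ε / 3)) := diam_mono hsub isBounded_ball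
          _ ≤ 2 * (ε / 3) := diam_ball (by positivity)
          _ < ε := by linarith
    · intro z hz
      have : (⟨z, hz⟩ : connectedComponentIn K x) ∈ ⋃ q ∈ t, V q := ht ▸ mem_univ _
      simp only [mem_iUnion] at this
      obtain ⟨q, hq, hzq⟩ := this
      exact ⟨_, ⟨q, hq, rfl⟩, ⟨z, hz⟩, hzq, rfl⟩
  choose! S hS1 hS2 hS3 using key
  have key' : ∀ Q ∈ {Q : Set ℂ | (∃ x ∈ K, Q = connectedComponentIn K x) ∧ ε < diam Q},
      ∃ x ∈ K, Q = connectedComponentIn K x := fun Q hQ => hQ.1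
  choose! x hxK hxQ using key'
  refine ⟨⋃ Q ∈ {Q : Set ℂ | (∃ x ∈ K, Q = connectedComponentIn K x) ∧ ε < diam Q}, S (x Q),
    (hfin ε hε).biUnion fun Q hQ => hS1 _ (hxK Q hQ), ?_, ?_⟩
  · intro P hP
    obtain ⟨Q, hQ, hPQ⟩ := mem_iUnion₂.1 hP
    exact hS2 _ (hxK Q hQ) P hPQ
  · intro z hz hzd
    have hQ : connectedComponentIn K z ∈
      {Q : Set ℂ | (∃ x ∈ K, Q = connectedComponentIn K x) ∧ ε < diam Q} := ⟨⟨z, hz, rfl⟩, hzd⟩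
    obtain ⟨P, hP, hzP⟩ := hS3 _ (hxK _ hQ) z (hxQ _ hQ ▸ mem_connectedComponentIn hz)
    exact ⟨P, mem_iUnion₂.2 ⟨_, hQ, hP⟩, hzP⟩

lemma IsPeanoCompactum.not_infinite_crosses {K : Set ℂ} (hK : IsPeanoCompactum K)
    (φ : ℂ ≃ᵢ ℂ) {a b : ℝ} (hab : a < b) :
    ¬ {Z | (∃ x, Z = connectedComponentIn (K ∩ {z | (φ z).re ∈ Icc a b}) x) ∧
      Crosses a b (φ '' Z)}.Infinite := by
  intro hinf
  obtain ⟨S, hS, hP, hcov⟩ := hK.exists_finite_cover (half_pos (sub_pos.2 hab))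
  have key : ∀ Z ∈ {Z | (∃ x, Z = connectedComponentIn (K ∩ {z | (φ z).re ∈ Icc a b}) x) ∧
      Crosses a b (φ '' Z)}, ∃ P ∈ S, P.Nonempty ∧ P ⊆ Z := by
    rintro Z ⟨⟨x, hZ⟩, hcr⟩
    obtain ⟨_, ⟨p, hpZ, rfl⟩, hpm⟩ := hcr.exists_re_eq (m := (a + b) / 2)
      ⟨by linarith, by linarith⟩
    obtain ⟨_, ⟨u, huZ, rfl⟩, hua⟩ := hcr.left
    obtain ⟨_, ⟨v, hvZ, rfl⟩, hvb⟩ := hcr.right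
    have hZK : Z ⊆ K := by
      rw [hZ]; exact (connectedComponentIn_subset _ _).trans inter_subset_left
    have hZp : IsPreconnected Z := by
      rw [hZ]; exact isPreconnected_connectedComponentIn
    have hZc : Z ⊆ connectedComponentIn K p := hZp.subset_connectedComponentIn hpZ hZK
    have hdiam : (b - a) / 2 < diam (connectedComponentIn K p) := by
      have h1 := abs_re_sub_re_le_dist φ v u
      have h2 : dist v u ≤ diam (connectedComponentIn K p) :=
        dist_le_diam_of_mem (hK.1.isBounded.subset (connectedComponentIn_subset _ _))
          (hZc hvZ) (hZc huZ)
      rw [hua, hvb] at h1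
      linarith [le_abs_self (b - a)]
    obtain ⟨P, hPS, hpP⟩ := hcov p (hZK hpZ) hdiam
    obtain ⟨hPc, hPK, hPb, hPd⟩ := hP P hPS
    refine ⟨P, hPS, ⟨p, hpP⟩, ?_⟩
    have : connectedComponentIn (K ∩ {z | (φ z).re ∈ Icc a b}) x =
        connectedComponentIn (K ∩ {z | (φ z).re ∈ Icc a b}) p :=
      connectedComponentIn_eq (hZ ▸ hpZ)
    rw [hZ, this]
    exact hPc.subset_connectedComponentIn hpP fun z hz =>
      ⟨hPK hz, re_mem_Icc_of_dist_le φ hpm ((dist_le_diam_of_mem hPb hz hpP).trans hPd.le)⟩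
  choose! P hPS hPne hPZ using key
  obtain ⟨Z, hZ, Z', hZ', hne, heq⟩ := hinf.exists_ne_map_eq_of_mapsTo hPS hS
  obtain ⟨p, hp⟩ := hPne Z hZ
  have h1 := hPZ Z hZ hp
  have h2 := hPZ Z' hZ' (heq ▸ hp)
  obtain ⟨⟨x, rfl⟩, -⟩ := hZ
  obtain ⟨⟨x', rfl⟩, -⟩ := hZ'
  exact hne (connectedComponentIn_eq_of_mem_inter h1 h2)

lemma IsPeanoCompactum.locallySeqAccessible {Ω : Set ℂ} (hΩ : IsOpen Ω) (hc : IsPreconnected Ω)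
    (hK : IsPeanoCompactum (frontier Ω)) (ξ : ℂ) : LocallySeqAccessible Ω ξ := by
  by_contra h
  obtain ⟨r, hr, k, y, γ, hinj, hγC, hγ, hγb⟩ := exists_crosses_of_not_locallySeqAccessible hΩ hc h
  have hγΩ : ∀ n, γ n ⊆ Ω := fun n =>
    (hγC n).trans ((connectedComponentIn_subset _ _).trans inter_subset_left)
  have him : ∀ z, boxNorm (z - ξ) ≤ r / 4 → (turn ξ k z).im ∈ Icc (-(r / 4)) (r / 4) := by
    intro z hz
    rw [← boxNorm_turn ξ k] at hz
    exact abs_le.1 ((le_max_right _ _).trans hz)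
  refine hK.not_infinite_crosses (turn ξ k) (by linarith : r / 8 < r / 4) <|
    Crosses.infinite_components_image hK.1 hγ (c := -(r / 4)) (d := r / 4)
      (fun n z hz => him z (hγb n z hz)) (fun n => ?_) ?_
  · refine disjoint_left.2 fun z hz hzf => ?_
    rw [hΩ.frontier_eq] at hzf
    exact hzf.2 (hγΩ n hz)
  · rintro i j hij M hM hMs ⟨p, hpM, hpi⟩ ⟨q, hqM, hqj⟩
    have hMΩ : M ⊆ Ω := by
      intro z hz
      by_contra hzΩ
      obtain ⟨w, hwM, hwf⟩ := hM.inter_frontier_nonempty' hpM hz (hγΩ i hpi) hzΩ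
      exact (hMs w hwM).2.2 hwf
    have hMO : M ⊆ Ω ∩ ball ξ r := by
      intro z hz
      refine ⟨hMΩ hz, ?_⟩
      obtain ⟨h1, h2, -⟩ := hMs z hz
      have : boxNorm (z - ξ) ≤ r / 4 := by
        rw [← boxNorm_turn ξ k]
        exact max_le (abs_le.2 ⟨by linarith [h1.1], h1.2⟩) (abs_le.2 h2)
      rw [mem_ball, dist_eq_norm]
      linarith [norm_le_two_mul_boxNorm (z - ξ)]
    have hq := hM.subset_connectedComponentIn hpM hMO hqM
    rw [← connectedComponentIn_eq (hγC i hpi)] at hq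
    exact hij (hinj (connectedComponentIn_eq_of_mem_inter hq (hγC j hqj)))

lemma IsArcFromTo.isPreconnected_sdiff_singleton {A : Set ℂ} {x y : ℂ} (h : IsArcFromTo A x y) :
    IsPreconnected (A \ {y}) := by
  obtain ⟨f, hf, hinj, rfl, -, rfl⟩ := h
  rw [← image_singleton, ← hinj.image_sdiff_subset (by simp), Icc_sdiff_right]
  exact isPreconnected_Ico.image _ (hf.mono Ico_subset_Icc_self)

lemma IsArcFromTo.isCompact {A : Set ℂ} {x y : ℂ} (h : IsArcFromTo A x y) : IsCompact A := by
  obtain ⟨f, hf, -, rfl, -⟩ := h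
  exact isCompact_Icc.image_of_continuousOn hf

lemma IsArcFromTo.isPreconnected {A : Set ℂ} {x y : ℂ} (h : IsArcFromTo A x y) :
    IsPreconnected A := by
  obtain ⟨f, hf, -, rfl, -⟩ := h
  exact isPreconnected_Icc.image _ hf

lemma IsArcFromTo.left_mem {A : Set ℂ} {x y : ℂ} (h : IsArcFromTo A x y) : x ∈ A := by
  obtain ⟨f, -, -, rfl, rfl, -⟩ := h
  exact mem_image_of_mem f (left_mem_Icc.2 zero_le_one)

lemma IsArcFromTo.right_mem {A : Set ℂ} {x y : ℂ} (h : IsArcFromTo A x y) : y ∈ A := by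
  obtain ⟨f, -, -, rfl, -, rfl⟩ := h
  exact mem_image_of_mem f (right_mem_Icc.2 zero_le_one)

/-- Local accessibility of all boundary points implies local sequential accessibility. -/
lemma locallySeqAccessible_of_locallyAccessible {Ω : Set ℂ} (hΩ : IsOpen Ω) (hc : IsPreconnected Ω)
    (hacc : ∀ x ∈ frontier Ω, LocallyAccessible Ω x) (ξ : ℂ) : LocallySeqAccessible Ω ξ := by
  by_contra h
  obtain ⟨r, hr, k, y, γ, hinj, hγC, hγ, hγb⟩ := exists_crosses_of_not_locallySeqAccessible hΩ hc h
  have hγΩ : ∀ n, γ n ⊆ Ω := fun n =>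
    (hγC n).trans ((connectedComponentIn_subset _ _).trans inter_subset_left)
  have hdisj : ∀ i j z, z ∈ connectedComponentIn (Ω ∩ ball ξ r) (y i) →
      z ∈ connectedComponentIn (Ω ∩ ball ξ r) (y j) → i = j := fun i j z hi hj =>
    hinj (connectedComponentIn_eq_of_mem_inter hi hj)
  have hmid : ∀ n, ∃ w ∈ γ n, (turn ξ k w).re = (r / 8 + r / 4) / 2 := fun n => by
    obtain ⟨_, ⟨p, hp, rfl⟩, hpm⟩ := (hγ n).exists_re_eq (m := (r / 8 + r / 4) / 2)
      ⟨by linarith, by linarith⟩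
    exact ⟨p, hp, hpm⟩
  choose w hwγ hwm using hmid
  have hnorm : ∀ z, boxNorm (z - ξ) ≤ r / 4 → dist z ξ ≤ r / 2 := fun z hz => by
    rw [dist_eq_norm]
    linarith [norm_le_two_mul_boxNorm (z - ξ)]
  obtain ⟨x, hx, σ, hσ, hlim⟩ := (isCompact_closedBall ξ (r / 2)).tendsto_subseq
    (fun n => mem_closedBall.2 (hnorm (w n) (hγb n _ (hwγ n))))
  have hxm : (turn ξ k x).re = (r / 8 + r / 4) / 2 :=
    tendsto_nhds_unique (((Complex.continuous_re.comp (turn ξ k).continuous).tendsto x).comp hlim)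
      (by simp only [Function.comp_def, hwm]; exact tendsto_const_nhds)
  have hxb : x ∈ ball ξ r := closedBall_subset_ball (by linarith) hx
  have hxΩ : x ∉ Ω := by
    intro hxΩ
    have hev := hlim.eventually ((hΩ.inter isOpen_ball).connectedComponentIn.mem_nhds
      (mem_connectedComponentIn (⟨hxΩ, hxb⟩ : x ∈ Ω ∩ ball ξ r)))
    obtain ⟨N, hN⟩ := hev.exists_forall_of_atTop
    have heq : ∀ n ≥ N, connectedComponentIn (Ω ∩ ball ξ r) (y (σ n)) =
        connectedComponentIn (Ω ∩ ball ξ r) x := fun n hn =>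
      connectedComponentIn_eq_of_mem_inter (hγC _ (hwγ _)) (hN n hn)
    have := hσ.injective (hinj ((heq N le_rfl).trans (heq (N + 1) (by omega)).symm))
    omega
  have hxf : x ∈ frontier Ω := by
    rw [hΩ.frontier_eq]
    exact ⟨mem_closure_of_tendsto hlim (Eventually.of_forall fun n => hγΩ _ (hwγ _)), hxΩ⟩
  obtain ⟨δ, hδ, hA⟩ := hacc x hxf (r / 16) (by positivity)
  obtain ⟨N, hN⟩ := (hlim.eventually (ball_mem_nhds x hδ)).exists_forall_of_atTop
  choose A hAarc hAΩ hAd using fun n => hA (w (σ (n + N))) (hγΩ _ (hwγ _))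
    (hN (n + N) (Nat.le_add_left _ _))
  have hAdist : ∀ n, ∀ z ∈ A n, dist z x ≤ r / 16 := fun n z hz =>
    (dist_le_diam_of_mem (hAarc n).isCompact.isBounded hz (hAarc n).right_mem).trans (hAd n).le
  have hwx : ∀ n, w n ≠ x := fun n he => hxΩ (he ▸ hγΩ n (hwγ n))
  have hAC : ∀ n, A n \ {x} ⊆ connectedComponentIn (Ω ∩ ball ξ r) (y (σ (n + N))) := by
    intro n
    rw [connectedComponentIn_eq (hγC _ (hwγ (σ (n + N))))]
    refine (hAarc n).isPreconnected_sdiff_singleton.subset_connectedComponentIn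
      ⟨(hAarc n).left_mem, hwx _⟩ fun z hz => ⟨(hAΩ n hz.1).resolve_right hz.2, ?_⟩
    have h1 := hAdist n z hz.1
    rw [mem_closedBall] at hx
    rw [mem_ball]
    linarith [dist_triangle z x ξ]
  obtain ⟨i, j, l, hij, hlj, H⟩ := Crosses.exists_between_image (φ := turn ξ k)
    (γ := fun n => γ (σ (n + N))) (fun n => hγ _) (fun i j hij => disjoint_left.2 fun z hi hj =>
      hij (add_left_injective N (hσ.injective (hdisj _ _ z (hγC _ hi) (hγC _ hj)))))
  obtain ⟨z, hz, hzj⟩ := H (A i ∪ A l)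
    ((hAarc i).isPreconnected.union x (hAarc i).right_mem (hAarc l).right_mem
      (hAarc l).isPreconnected)
    (fun z hz => re_mem_Icc_of_dist_le _ hxm (by
      have := hz.elim (hAdist i z) (hAdist l z)
      linarith))
    ⟨_, Or.inl (hAarc i).left_mem, hwγ _⟩ ⟨_, Or.inr (hAarc l).left_mem, hwγ _⟩
  have hzx : z ≠ x := fun he => hxΩ (he ▸ hγΩ _ hzj)
  rcases hz with hz | hz
  · exact hij (add_left_injective N (hσ.injective (hdisj _ _ z (hAC i ⟨hz, hzx⟩) (hγC _ hzj))))
  · exact hlj (add_left_injective N (hσ.injective (hdisj _ _ z (hAC l ⟨hz, hzx⟩) (hγC _ hzj))))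

lemma exists_first_mem {X : Type*} [TopologicalSpace X] {f : ℝ → X} {a b : ℝ} (hab : a ≤ b)
    (hf : ContinuousOn f (Icc a b)) {G : Set X} (hG : IsClosed G) (hb : f b ∈ G) :
    ∃ t ∈ Icc a b, f t ∈ G ∧ ∀ u ∈ Ico a t, f u ∉ G := by
  obtain ⟨t, ⟨ht, htG⟩, hmin⟩ := (isCompact_Icc.of_isClosed_subset
    (hf.preimage_isClosed_of_isClosed isClosed_Icc hG) inter_subset_left).exists_isLeast
    ⟨b, right_mem_Icc.2 hab, hb⟩
  exact ⟨t, ht, htG, fun u hu huG => hu.2.not_ge (hmin ⟨⟨hu.1, hu.2.le.trans ht.2⟩, huG⟩)⟩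

/-- `x` and `y` are the endpoints of a possibly degenerate arc in `U`. -/
def ArcJoined (U : Set ℂ) (x y : ℂ) : Prop :=
  ∃ (f : ℝ → ℂ) (T : ℝ), 0 ≤ T ∧ ContinuousOn f (Icc 0 T) ∧ InjOn f (Icc 0 T) ∧
    f 0 = x ∧ f T = y ∧ MapsTo f (Icc 0 T) U

lemma ArcJoined.trans {U : Set ℂ} {x y z : ℂ} (h₁ : ArcJoined U x y) (h₂ : ArcJoined U y z) :
    ArcJoined U x z := by
  obtain ⟨f, T, hT, hf, hfi, rfl, rfl, hfU⟩ := h₁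
  obtain ⟨g, S, hS, hg, hgi, hg0, rfl, hgU⟩ := h₂
  obtain ⟨t, ht, ⟨s, hs, hst⟩, hmin⟩ := exists_first_mem hT hf
    (isCompact_Icc.image_of_continuousOn hg).isClosed ⟨0, left_mem_Icc.2 hS, hg0⟩
  have hmaps : ∀ u ∈ Icc t (t + (S - s)), u - t + s ∈ Icc 0 S := fun u hu =>
    ⟨by linarith [hu.1, hs.1], by linarith [hu.2]⟩
  have hle : t ≤ t + (S - s) := by linarith [hs.2]
  have h1 : EqOn (fun u => if u ≤ t then f u else g (u - t + s)) f (Icc 0 t) :=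
    fun u hu => if_pos hu.2
  have h2 : EqOn (fun u => if u ≤ t then f u else g (u - t + s)) (fun u => g (u - t + s))
      (Icc t (t + (S - s))) := fun u hu => by
    rcases hu.1.eq_or_lt with rfl | hlt
    · simp [hst]
    · exact if_neg hlt.not_ge
  have hcross : ∀ u ∈ Icc 0 t, ∀ v ∈ Ioc t (t + (S - s)), f u ≠ g (v - t + s) := by
    intro u hu v hv he
    have hvS := hmaps v ⟨hv.1.le, hv.2⟩
    rcases hu.2.eq_or_lt with rfl | hlt
    · have := hgi hs hvS (hst.trans he)
      linarith [hv.1]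
    · exact hmin u ⟨hu.1, hlt⟩ (he ▸ mem_image_of_mem g hvS)
  refine ⟨fun u => if u ≤ t then f u else g (u - t + s), t + (S - s), ht.1.trans hle, ?_, ?_,
    if_pos ht.1, ?_, ?_⟩
  · rw [← Icc_union_Icc_eq_Icc ht.1 hle]
    refine ContinuousOn.union_of_isClosed ?_ ?_ isClosed_Icc isClosed_Icc
    · exact (hf.mono (Icc_subset_Icc_right ht.2)).congr h1
    · exact (hg.comp (by fun_prop) hmaps).congr h2
  · intro u hu v hv huv
    dsimp only at huv
    split_ifs at huv with h h' h'
    · exact hfi ⟨hu.1, h.trans ht.2⟩ ⟨hv.1, h'.trans ht.2⟩ huv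
    · exact (hcross u ⟨hu.1, h⟩ v ⟨not_le.1 h', hv.2⟩ huv).elim
    · exact (hcross v ⟨hv.1, h'⟩ u ⟨not_le.1 h, hu.2⟩ huv.symm).elim
    · have := hgi (hmaps u ⟨(not_le.1 h).le, hu.2⟩) (hmaps v ⟨(not_le.1 h').le, hv.2⟩) huv
      linarith
  · refine (h2 (right_mem_Icc.2 hle)).trans ?_
    simp
  · intro u hu
    dsimp only
    split_ifs with h
    · exact hfU ⟨hu.1, h.trans ht.2⟩
    · exact hgU (hmaps u ⟨(not_le.1 h).le, hu.2⟩)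

lemma arcJoined_of_convex {U : Set ℂ} (hU : Convex ℝ U) {x y : ℂ} (hx : x ∈ U) (hy : y ∈ U) :
    ArcJoined U x y := by
  rcases eq_or_ne x y with rfl | hne
  · exact ⟨fun _ => x, 0, le_rfl, continuousOn_const, by simp, rfl, rfl, fun _ _ => hx⟩
  · exact ⟨AffineMap.lineMap x y, 1, zero_le_one, AffineMap.lineMap_continuous.continuousOn,
      (AffineMap.lineMap_injective ℝ hne).injOn, AffineMap.lineMap_apply_zero _ _,
      AffineMap.lineMap_apply_one _ _, fun t ht => hU.lineMap_mem hx hy ht⟩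

lemma ArcJoined.mono {U V : Set ℂ} {x y : ℂ} (h : ArcJoined U x y) (hUV : U ⊆ V) :
    ArcJoined V x y := by
  obtain ⟨f, T, hT, hf, hfi, h0, h1, hfU⟩ := h
  exact ⟨f, T, hT, hf, hfi, h0, h1, hfU.mono_right hUV⟩

/-- Connected open subsets of the plane are arcwise connected. -/
lemma IsPreconnected.arcJoined {U : Set ℂ} (hc : IsPreconnected U) (hU : IsOpen U) {x y : ℂ}
    (hx : x ∈ U) (hy : y ∈ U) : ArcJoined U x y := by
  refine hc.induction₂' (ArcJoined U) (fun z hz => ?_) (fun _ _ _ _ _ _ => ArcJoined.trans) hx hy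
  obtain ⟨ρ, hρ, hball⟩ := Metric.isOpen_iff.1 hU z hz
  filter_upwards [mem_nhdsWithin_of_mem_nhds (ball_mem_nhds z hρ)] with w hw
  exact ⟨(arcJoined_of_convex (convex_ball z ρ) (mem_ball_self hρ) hw).mono hball,
    (arcJoined_of_convex (convex_ball z ρ) hw (mem_ball_self hρ)).mono hball⟩

/-- Near a boundary point of finite connectedness, only components of `Ω ∩ ball x r` accumulating
at `x` occur. -/
lemma FinitelyConnectedAt.exists_mem_closure {Ω : Set ℂ} {x : ℂ} (h : FinitelyConnectedAt Ω x)
    {r : ℝ} (hr : 0 < r) : ∃ δ > 0, ∀ z ∈ Ω ∩ ball x δ,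
      z ∈ ball x r ∧ x ∈ closure (connectedComponentIn (Ω ∩ ball x r) z) := by
  obtain ⟨U, hU, hxU, hUr, hfin⟩ := h r hr
  have hclosed : IsClosed (⋃ Q ∈ {Q : Set ℂ | (∃ y ∈ U ∩ Ω, Q = connectedComponentIn (U ∩ Ω) y) ∧
      x ∉ closure Q}, closure Q) :=
    (hfin.subset fun Q hQ => hQ.1).isClosed_biUnion fun Q _ => isClosed_closure
  have hx : x ∉ ⋃ Q ∈ {Q : Set ℂ | (∃ y ∈ U ∩ Ω, Q = connectedComponentIn (U ∩ Ω) y) ∧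
      x ∉ closure Q}, closure Q := by
    intro hx
    obtain ⟨Q, hQ, hxQ⟩ := mem_iUnion₂.1 hx
    exact hQ.2 hxQ
  obtain ⟨δ, hδ, hball⟩ := Metric.isOpen_iff.1 (hU.inter hclosed.isOpen_compl) x ⟨hxU, hx⟩
  refine ⟨δ, hδ, fun z hz => ⟨hUr (hball hz.2).1, ?_⟩⟩
  have hzU : z ∈ U ∩ Ω := ⟨(hball hz.2).1, hz.1⟩
  by_contra hcl
  refine (hball hz.2).2 (mem_iUnion₂.2 ⟨connectedComponentIn (U ∩ Ω) z, ⟨⟨z, hzU, rfl⟩,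
    fun hcl' => hcl (closure_mono ?_ hcl')⟩, subset_closure (mem_connectedComponentIn hzU)⟩)
  exact connectedComponentIn_mono _ fun w hw => ⟨hw.2, hUr hw.1⟩

/-- Countably many arcs, consecutive ones sharing an endpoint and otherwise disjoint, that shrink
to `x` concatenate to an arc ending at `x`. -/
lemma exists_isArcFromTo_of_seq {x : ℂ} {d : ℕ → ℝ → ℂ} (hd : ∀ n, ContinuousOn (d n) (Icc 0 1))
    (hinj : ∀ n, InjOn (d n) (Icc 0 1)) (hnext : ∀ n, d n 1 = d (n + 1) 0)
    (hdisj : ∀ m n, m < n → ∀ u ∈ Ico (0 : ℝ) 1, ∀ v ∈ Icc (0 : ℝ) 1, d m u ≠ d n v)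
    (hx : ∀ n, ∀ u ∈ Icc (0 : ℝ) 1, d n u ≠ x)
    {ρ : ℕ → ℝ} (hρ : Tendsto ρ atTop (𝓝 0))
    (hdρ : ∀ n, ∀ u ∈ Icc (0 : ℝ) 1, dist (d n u) x ≤ ρ n) :
    ∃ A, IsArcFromTo A (d 0 0) x ∧ A ⊆ (⋃ n, d n '' Icc 0 1) ∪ {x} := by
  set F : ℝ → ℂ := fun t => d ⌊t⌋₊ (t - ⌊t⌋₊) with hF
  have hfr : ∀ t : ℝ, 0 ≤ t → t - ⌊t⌋₊ ∈ Ico (0 : ℝ) 1 := fun t ht =>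
    ⟨sub_nonneg.2 (Nat.floor_le ht), by linarith [Nat.lt_floor_add_one t]⟩
  have hFeq : ∀ n : ℕ, EqOn F (fun t => d n (t - n)) (Icc n (n + 1)) := by
    intro n t ht
    rcases ht.2.eq_or_lt with rfl | hlt
    · have : ⌊(n : ℝ) + 1⌋₊ = n + 1 := by exact_mod_cast Nat.floor_natCast (R := ℝ) (n + 1)
      simp [hF, this, hnext]
    · have : ⌊t⌋₊ = n := (Nat.floor_eq_iff ((Nat.cast_nonneg n).trans ht.1)).2 ⟨ht.1, hlt⟩
      simp [hF, this]
  have hFcont : ∀ n : ℕ, ContinuousOn F (Icc 0 n) := by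
    intro n
    induction n with
    | zero => simp
    | succ n ih =>
      push_cast
      rw [← Icc_union_Icc_eq_Icc n.cast_nonneg (by linarith : (n : ℝ) ≤ n + 1)]
      refine ih.union_of_isClosed (ContinuousOn.congr ?_ (hFeq n)) isClosed_Icc isClosed_Icc
      exact (hd n).comp (by fun_prop) fun t ht => ⟨by linarith [ht.1], by linarith [ht.2]⟩
  have hFc : ContinuousOn F (Ici 0) := by
    intro t ht
    obtain ⟨n, hn⟩ := exists_nat_gt t
    refine (hFcont n t ⟨ht, hn.le⟩).mono_of_mem_nhdsWithin ?_
    filter_upwards [self_mem_nhdsWithin, mem_nhdsWithin_of_mem_nhds (Iio_mem_nhds hn)] with u h1 h2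
    exact ⟨h1, le_of_lt h2⟩
  have hFinj : InjOn F (Ici 0) := by
    intro t ht u hu he
    rcases lt_trichotomy ⌊t⌋₊ ⌊u⌋₊ with h | h | h
    · exact (hdisj _ _ h _ (hfr t ht) _ (Ico_subset_Icc_self (hfr u hu)) he).elim
    · simp only [hF, h] at he
      have := hinj _ (h ▸ Ico_subset_Icc_self (hfr t ht)) (Ico_subset_Icc_self (hfr u hu)) he
      linarith
    · exact (hdisj _ _ h _ (hfr u hu) _ (Ico_subset_Icc_self (hfr t ht)) he.symm).elim
  have hFlim : Tendsto F atTop (𝓝 x) := by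
    rw [tendsto_iff_dist_tendsto_zero]
    refine squeeze_zero' (Eventually.of_forall fun _ => dist_nonneg) ?_
      (hρ.comp (tendsto_nat_floor_atTop (α := ℝ)))
    filter_upwards [eventually_ge_atTop 0] with t ht
    exact hdρ _ _ (Ico_subset_Icc_self (hfr t ht))
  have hFx : ∀ t, 0 ≤ t → F t ≠ x := fun t ht => hx _ _ (Ico_subset_Icc_self (hfr t ht))
  have hpos : ∀ t ∈ Ico (0 : ℝ) 1, 0 ≤ t / (1 - t) := fun t ht =>
    div_nonneg ht.1 (by linarith [ht.2])
  have hGlt : ∀ {t : ℝ}, t < 1 → (if t < 1 then F (t / (1 - t)) else x) = F (t / (1 - t)) :=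
    fun h => if_pos h
  refine ⟨_, ⟨fun t => if t < 1 then F (t / (1 - t)) else x, ?_, ?_, rfl, ?_, ?_⟩, ?_⟩
  · intro t ht
    rcases ht.2.eq_or_lt with rfl | hlt
    · refine ContinuousWithinAt.mono (t := Iic 1) ?_ Icc_subset_Iic_self
      rw [← continuousWithinAt_sdiff_self, Iic_sdiff_right]
      have hlim : Tendsto (fun t : ℝ => t / (1 - t)) (𝓝[<] 1) atTop := by
        simp_rw [div_eq_mul_inv]
        refine Tendsto.pos_mul_atTop one_pos (tendsto_nhdsWithin_of_tendsto_nhds tendsto_id) ?_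
        refine tendsto_inv_nhdsGT_zero.comp (tendsto_nhdsWithin_iff.2 ⟨?_, ?_⟩)
        · refine tendsto_nhdsWithin_of_tendsto_nhds ?_
          have : Continuous fun t : ℝ => 1 - t := by fun_prop
          simpa using this.tendsto 1
        · filter_upwards [self_mem_nhdsWithin] with t ht
          exact sub_pos.2 (mem_Iio.1 ht)
      simp only [ContinuousWithinAt, lt_irrefl, if_false]
      refine (hFlim.comp hlim).congr' ?_
      filter_upwards [self_mem_nhdsWithin] with t ht
      exact (hGlt ht).symm
    · have hca : ContinuousWithinAt (fun t : ℝ => t / (1 - t)) (Ico 0 1) t :=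
        continuousWithinAt_id.div (continuousWithinAt_const.sub continuousWithinAt_id)
          (by linarith)
      have := ContinuousWithinAt.comp (g := F) (f := fun t : ℝ => t / (1 - t))
        (hFc _ (hpos t ⟨ht.1, hlt⟩)) hca hpos
      refine (this.congr (fun u hu => hGlt hu.2) (hGlt hlt)).mono_of_mem_nhdsWithin ?_
      filter_upwards [self_mem_nhdsWithin, mem_nhdsWithin_of_mem_nhds (Iio_mem_nhds hlt)]
        with u h1 h2
      exact ⟨h1.1, h2⟩
  · intro t ht u hu he
    dsimp only at he
    split_ifs at he with h h' h'
    · have := hFinj (hpos t ⟨ht.1, h⟩) (hpos u ⟨hu.1, h'⟩) he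
      rw [div_eq_div_iff (by linarith) (by linarith)] at this
      linarith
    · exact (hFx _ (hpos t ⟨ht.1, h⟩) he).elim
    · exact (hFx _ (hpos u ⟨hu.1, h'⟩) he.symm).elim
    · linarith [ht.2, hu.2]
  · simp [hF]
  · simp
  · rintro _ ⟨t, ht, rfl⟩
    dsimp only
    split_ifs with h
    · exact Or.inl (mem_iUnion.2
        ⟨_, mem_image_of_mem _ (Ico_subset_Icc_self (hfr _ (hpos t ⟨ht.1, h⟩)))⟩)
    · exact Or.inr rfl

lemma FinitelyConnectedAt.exists_arcJoined {Ω : Set ℂ} (hΩ : IsOpen Ω) {x : ℂ}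
    (h : FinitelyConnectedAt Ω x) (hxΩ : x ∉ Ω) {p : ℂ} {r ρ : ℝ} (hp : p ∈ Ω ∩ ball x r)
    (hcl : x ∈ closure (connectedComponentIn (Ω ∩ ball x r) p)) (hρ : 0 < ρ) :
    ∃ p' ∈ Ω ∩ ball x ρ, x ∈ closure (connectedComponentIn (Ω ∩ ball x ρ) p') ∧
      ∃ ρ' > 0, ρ' ≤ ρ / 2 ∧ ArcJoined (Ω ∩ (ball x r \ ball x ρ')) p p' := by
  have hO : IsOpen (Ω ∩ ball x r) := hΩ.inter isOpen_ball
  obtain ⟨δ, hδ, hδ'⟩ := h.exists_mem_closure hρ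
  obtain ⟨p', hp', hpC⟩ := mem_closure_iff_nhds.1 hcl _ (ball_mem_nhds x hδ)
  have hpΩ : p' ∈ Ω := (connectedComponentIn_subset _ _ hpC).1
  obtain ⟨f, T, hT, hf, hfi, hf0, hfT, hfU⟩ :=
    isPreconnected_connectedComponentIn.arcJoined hO.connectedComponentIn
      (mem_connectedComponentIn hp) hpC
  obtain ⟨q, ⟨t, ht, rfl⟩, hq⟩ := (isCompact_Icc.image_of_continuousOn hf).exists_infDist_eq_dist
    ⟨_, mem_image_of_mem f (left_mem_Icc.2 hT)⟩ x
  have hsub : ∀ t ∈ Icc 0 T, f t ∈ Ω ∩ ball x r := fun t ht =>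
    connectedComponentIn_subset _ _ (hfU ht)
  have hqpos : 0 < dist x (f t) := dist_pos.2 fun he => hxΩ (he ▸ (hsub t ht).1)
  refine ⟨p', ⟨hpΩ, (hδ' p' ⟨hpΩ, hp'⟩).1⟩, (hδ' p' ⟨hpΩ, hp'⟩).2, min (dist x (f t)) (ρ / 2),
    lt_min hqpos (half_pos hρ), min_le_right _ _, f, T, hT, hf, hfi, hf0, hfT, fun u hu =>
      ⟨(hsub u hu).1, (hsub u hu).2, fun hmem => ?_⟩⟩
  have h1 : dist x (f t) ≤ dist x (f u) := hq ▸ infDist_le_dist_of_mem (mem_image_of_mem f hu)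
  have h2 : dist (f u) x < dist x (f t) := lt_of_lt_of_le hmem (min_le_left _ _)
  rw [dist_comm] at h2
  linarith

/-- Arcs `E n` in nested components, where only consecutive arcs may meet. -/
lemma FinitelyConnectedAt.exists_arcJoined_seq {Ω : Set ℂ} (hΩ : IsOpen Ω) {x : ℂ}
    (h : FinitelyConnectedAt Ω x) (hxΩ : x ∉ Ω) {z : ℂ} {r : ℝ} (hz : z ∈ Ω ∩ ball x r)
    (hcl : x ∈ closure (connectedComponentIn (Ω ∩ ball x r) z)) :
    ∃ (p : ℕ → ℂ) (R : ℕ → ℝ), p 0 = z ∧ R 0 = r ∧ z ∉ ball x (R 1) ∧ (∀ n, 0 < R n) ∧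
      (∀ n, R (n + 1) ≤ R n / 2) ∧
      ∀ n, ArcJoined (Ω ∩ (ball x (R n) \ ball x (R (n + 2)))) (p n) (p (n + 1)) := by
  have hr : 0 < r := pos_of_mem_ball hz.2
  have step : ∀ s : {s : ℂ × ℝ × ℝ // s.1 ∈ Ω ∩ ball x s.2.1 ∧
      x ∈ closure (connectedComponentIn (Ω ∩ ball x s.2.1) s.1) ∧ 0 < s.2.2},
      ∃ s' : {s : ℂ × ℝ × ℝ // s.1 ∈ Ω ∩ ball x s.2.1 ∧
        x ∈ closure (connectedComponentIn (Ω ∩ ball x s.2.1) s.1) ∧ 0 < s.2.2},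
        s'.1.2.1 = s.1.2.2 ∧ s'.1.2.2 ≤ s.1.2.2 / 2 ∧
        ArcJoined (Ω ∩ (ball x s.1.2.1 \ ball x s'.1.2.2)) s.1.1 s'.1.1 := by
    rintro ⟨⟨p, r, ρ⟩, hp, hcl, hρ⟩
    obtain ⟨p', hp', hcl', ρ', hρ', hle, hA⟩ := h.exists_arcJoined hΩ hxΩ hp hcl hρ
    exact ⟨⟨(p', ρ, ρ'), hp', hcl', hρ'⟩, rfl, hle, hA⟩
  choose next h1 h2 h3 using step
  have hzx : 0 < dist z x := dist_pos.2 fun he => hxΩ (he ▸ hz.1)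
  have hρ : 0 < min (dist z x) (r / 2) := lt_min hzx (half_pos hr)
  set S : ℕ → _ := fun n => next^[n] ⟨(z, r, min (dist z x) (r / 2)), hz, hcl, hρ⟩ with hS
  have hS1 : ∀ n, S (n + 1) = next (S n) := fun n => Function.iterate_succ_apply' _ _ _
  have hR : ∀ n, (S (n + 1)).1.2.1 = (S n).1.2.2 := fun n => by rw [hS1, h1]
  refine ⟨fun n => (S n).1.1, fun n => (S n).1.2.1, rfl, rfl, ?_,
    fun n => pos_of_mem_ball (S n).2.1.2, ?_, fun n => ?_⟩
  · simp only [hR, mem_ball, not_lt]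
    exact min_le_left _ _
  · rintro (_ | n)
    · simp only [hR]
      exact min_le_right _ _
    · simp only [hR]
      rw [hS1]
      exact h2 _
  · have := h3 (S n)
    rwa [← hS1, ← hR (n + 1)] at this

lemma FinitelyConnectedAt.locallyAccessible {Ω : Set ℂ} (hΩ : IsOpen Ω) {x : ℂ}
    (h : FinitelyConnectedAt Ω x) (hxΩ : x ∉ Ω) : LocallyAccessible Ω x := by
  intro ε hε
  obtain ⟨δ, hδ, hδ'⟩ := h.exists_mem_closure (by positivity : 0 < ε / 3)
  refine ⟨δ, hδ, fun z hz hzδ => ?_⟩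
  obtain ⟨hzε, hcl⟩ := hδ' z ⟨hz, hzδ⟩
  obtain ⟨p, R, rfl, hR0, hzR, hRpos, hR, hE⟩ := h.exists_arcJoined_seq hΩ hxΩ ⟨hz, hzε⟩ hcl
  choose f T hT hf hfi hf0 hfT hfU using hE
  have hanti : Antitone R := antitone_nat_of_succ_le fun n => by linarith [hR n, hRpos n]
  have hRlim : Tendsto R atTop (𝓝 0) := by
    have hle : ∀ n, R n ≤ ε / 3 * (1 / 2) ^ n := fun n => by
      induction n with
      | zero => simp [hR0]
      | succ n ih => rw [pow_succ]; linarith [hR n]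
    refine squeeze_zero (fun n => (hRpos n).le) hle ?_
    simpa using (tendsto_pow_atTop_nhds_zero_of_lt_one (by norm_num : (0 : ℝ) ≤ 1 / 2)
      (by norm_num)).const_mul (ε / 3)
  have hfar : ∀ m n, m + 2 ≤ n → ∀ u ∈ Icc 0 (T m), ∀ v ∈ Icc 0 (T n), f m u ≠ f n v :=
    fun m n hmn u hu v hv he => (hfU m hu).2.2
      (ball_subset_ball (hanti hmn) (he ▸ (hfU n hv).2.1))
  have hcut : ∀ n s, s ∈ Icc 0 (T n) → ∃ t s', t ∈ Icc s (T n) ∧ s' ∈ Icc 0 (T (n + 1)) ∧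
      f n t = f (n + 1) s' ∧ ∀ u ∈ Ico s t, f n u ∉ f (n + 1) '' Icc 0 (T (n + 1)) := by
    intro n s hs
    obtain ⟨t, ht, ⟨s', hs', he⟩, hmin⟩ := exists_first_mem hs.2
      ((hf n).mono (Icc_subset_Icc_left hs.1))
      (isCompact_Icc.image_of_continuousOn (hf (n + 1))).isClosed
      ⟨0, left_mem_Icc.2 (hT _), (hf0 _).trans (hfT n).symm⟩
    exact ⟨t, s', ht, hs', he.symm, hmin⟩
  choose! cut start hcutmem hstartmem heq hmiss using hcut
  set S : ℕ → ℝ := fun n => Nat.rec 0 (fun k s => start k s) n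
  have hS : ∀ n, S n ∈ Icc 0 (T n) := fun n => by
    induction n with
    | zero => exact left_mem_Icc.2 (hT 0)
    | succ n ih => exact hstartmem n _ ih
  have hlink : ∀ n, f n (cut n (S n)) = f (n + 1) (S (n + 1)) := fun n => heq n _ (hS n)
  have hlt : ∀ n, S n < cut n (S n) := by
    intro n
    refine (hcutmem n _ (hS n)).1.lt_of_ne fun he => ?_
    have hn := hlink n
    rw [← he] at hn
    cases n with
    | zero => exact hzR (hf0 0 ▸ hn ▸ (hfU 1 (hS 1)).2.1)
    | succ n =>
      refine hfar n (n + 2) le_rfl _ ⟨(hS n).1.trans (hcutmem n _ (hS n)).1,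
        (hcutmem n _ (hS n)).2⟩ _ (hS (n + 2)) ((hlink n).trans hn)
  have hmaps : ∀ n, ∀ u ∈ Icc (0 : ℝ) 1, S n + u * (cut n (S n) - S n) ∈ Icc 0 (T n) := by
    intro n u hu
    have h1 := (hS n).1
    have h2 := (hcutmem n _ (hS n)).2
    have h3 := hlt n
    constructor <;> nlinarith [hu.1, hu.2]
  obtain ⟨A, hA, hAsub⟩ := exists_isArcFromTo_of_seq (x := x)
    (d := fun n u => f n (S n + u * (cut n (S n) - S n))) (ρ := R)
    (fun n => (hf n).comp (by fun_prop) (hmaps n))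
    (fun n u hu v hv he => by
      have := hfi n (hmaps n u hu) (hmaps n v hv) he
      exact mul_right_cancel₀ (sub_pos.2 (hlt n)).ne' (add_left_cancel this))
    (fun n => by simpa using hlink n)
    (fun m n hmn u hu v hv he => by
      rcases (Nat.succ_le_of_lt hmn).eq_or_lt with rfl | hlt'
      · refine hmiss m _ (hS m) _ ⟨?_, ?_⟩ ⟨_, hmaps (m + 1) v hv, he.symm⟩
        · nlinarith [hlt m, hu.1]
        · nlinarith [hlt m, hu.2]
      · exact hfar m n hlt' _ (hmaps m u (Ico_subset_Icc_self hu)) _ (hmaps n v hv) he)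
    (fun n u hu he => hxΩ (he ▸ (hfU n (hmaps n u hu)).1))
    hRlim (fun n u hu => le_of_lt (hfU n (hmaps n u hu)).2.1)
  have hAΩ : A ⊆ Ω ∩ ball x (ε / 3) ∪ {x} := by
    refine hAsub.trans (union_subset_union_left _ (iUnion_subset fun n => ?_))
    rintro _ ⟨u, hu, rfl⟩
    have := hfU n (hmaps n u hu)
    exact ⟨this.1, ball_subset_ball (hR0 ▸ hanti n.zero_le) this.2.1⟩
  refine ⟨A, by simpa [S, hf0] using hA,
    hAΩ.trans (union_subset_union_left _ inter_subset_left), ?_⟩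
  calc diam A ≤ diam (ball x (ε / 3)) := diam_mono (hAΩ.trans (union_subset inter_subset_right
        (singleton_subset_iff.2 (mem_ball_self (by positivity))))) isBounded_ball
    _ ≤ 2 * (ε / 3) := diam_ball (by positivity)
    _ < ε := by linarith

/-- Theorem C: six equivalent conditions for the boundary of a bounded planar domain
to be a Peano compactum. -/
theorem stmt_2 (Ω : Set ℂ) (hΩ : IsPlanarDomain Ω) (hb : Bornology.IsBounded Ω) :
    List.TFAE
      [IsPeanoCompactum (frontier Ω),
       PropertyS Ω,
       ∀ x ∈ frontier Ω, LocallyAccessible Ω x,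
       ∀ x ∈ frontier Ω, LocallySeqAccessible Ω x,
       ∀ x ∈ frontier Ω, FinitelyConnectedAt Ω x,
       MazCompletionCompact Ω] := by
  obtain ⟨-, ho, hc⟩ := hΩ
  tfae_have 1 → 4 := fun h x _ => h.locallySeqAccessible ho hc.isPreconnected x
  tfae_have 4 → 5 := fun h x hx => (h x hx).finitelyConnectedAt ho
  tfae_have 5 → 2 := propertyS_of_finitelyConnectedAt ho hb
  tfae_have 2 → 1 := fun h => h.isPeanoCompactum_frontier ho hb
  tfae_have 2 → 6 := fun h => h.mazCompletionCompact
  tfae_have 6 → 4 := fun h x _ => h.locallySeqAccessible hc hb x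
  tfae_have 5 → 3 := fun h x hx => (h x hx).locallyAccessible ho (ho.frontier_eq ▸ hx).2
  tfae_have 3 → 4 := fun h x _ =>
    locallySeqAccessible_of_locallyAccessible ho hc.isPreconnected h x
  tfae_finish
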